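/- Let D be a non-commutative locally finite division ring with center F, and let G be a subnormal subgroup of GL_n(D) for some n ≥ 1. If M is a non-abelian solvable maximal subgroup of G, then n = 1. -/

import Mathlib

/-- A subgroup `H` of a group is subnormal if there is a finite chain of subgroups
from `H` up to the whole group, each normal in the next. -/
def IsSubnormal {Γ : Type*} [Group Γ] (H : Subgroup Γ) : Prop :=
  ∃ (k : ℕ) (s : ℕ → Subgroup Γ), s 0 = H ∧ s k = ⊤ ∧
    ∀ i < k, s i ≤ s (i + 1) ∧ ((s i).subgroupOf (s (i + 1))).Normal

/-- A division ring `D` with center `F` is locally finite if for every finite subset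
`S` of `D` the division subring generated by `F ∪ S` is finite-dimensional over `F`. -/
def IsLocallyFiniteDivisionRing (D : Type*) [DivisionRing D] : Prop :=
  ∀ S : Set D, S.Finite →
    ∃ t : Finset D,
      (Subfield.closure (S ∪ (Subring.center D : Set D)) : Set D) ⊆
        ((Submodule.span (Subring.center D) (t : Set D) :
          Submodule (Subring.center D) D) : Set D)

section PartOne

theorem exists_derived_step {Γ : Type*} [Group Γ] [Group.IsSolvable Γ] (Z : Subgroup Γ)
    (h : ¬ (∀ x : Γ, x ∈ Z)) :
    ∃ N : Subgroup Γ, N.Normal ∧ (∃ x ∈ N, x ∉ Z) ∧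
      ∀ x ∈ N, ∀ y ∈ N, x * y * x⁻¹ * y⁻¹ ∈ Z := by
  classical
  obtain ⟨k, hk⟩ := Group.IsSolvable.solvable (G := Γ)
  have hex : ∃ k, derivedSeries Γ k ≤ Z := ⟨k, by rw [hk]; exact bot_le⟩
  have h1 := Nat.find_spec hex
  have h0 : Nat.find hex ≠ 0 := by
    intro h0
    rw [h0] at h1
    exact h fun x => h1 (by simp)
  obtain ⟨j, hj⟩ := Nat.exists_eq_succ_of_ne_zero h0
  have h2 := Nat.find_min hex (m := j) (by omega)
  rw [hj] at h1
  refine ⟨derivedSeries Γ j, derivedSeries_normal _ _, ?_, ?_⟩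
  · exact Set.not_subset.1 h2
  · intro x hx y hy
    apply h1
    rw [derivedSeries_succ]
    exact Subgroup.commutator_mem_commutator hx hy

theorem hua_abelian {D : Type*} [DivisionRing D] (N : Subgroup Dˣ) [N.Normal]
    (hab : ∀ x ∈ N, ∀ y ∈ N, x * y = y * x) (x : Dˣ) (hx : x ∈ N) (y : D) :
    (x : D) * y = y * x := by
  by_contra hne
  have hy0 : y ≠ 0 := by rintro rfl; simp at hne
  have hy1 : y + 1 ≠ 0 := by
    intro h
    apply hne
    rw [eq_neg_of_add_eq_zero_left h]; simp
  have conj : ∀ u : Dˣ, x * u * x⁻¹ * u⁻¹ ∈ N := by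
    intro u
    have := N.mul_mem hx (Subgroup.Normal.conj_mem ‹N.Normal› _ (N.inv_mem hx) u)
    simpa [mul_assoc] using this
  set u := Units.mk0 y hy0
  set w := Units.mk0 (y + 1) hy1
  set a := x * u * x⁻¹ * u⁻¹ with ha
  set b := x * w * x⁻¹ * w⁻¹ with hb
  have hau : (a : D) * y * x = x * y := by
    have : a * u * x = x * u := by rw [ha]; group
    have := congrArg (Units.val) this
    simpa [u] using this
  have hbw : (b : D) * (y + 1) * x = x * (y + 1) := by
    have : b * w * x = x * w := by rw [hb]; group
    have := congrArg (Units.val) this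
    simpa [w] using this
  have hxa : (x : D) * a = a * x := by
    have := congrArg (Units.val) (hab x hx a (conj u)); simpa using this
  have hxb : (x : D) * b = b * x := by
    have := congrArg (Units.val) (hab x hx b (conj w)); simpa using this
  have key : ((a : D) - b) * y = b - 1 := by
    have h1 : (((a : D) - b) * y - (b - 1)) * x = 0 := by
      have e : (((a : D) - b) * y - (b - 1)) * x = (a : D) * y * x - b * (y + 1) * x + x := by
        noncomm_ring
      rw [e, hau, hbw]; noncomm_ring
    have := (mul_eq_zero.1 h1).resolve_right x.ne_zero
    exact sub_eq_zero.1 this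
  by_cases hab' : (a : D) - b = 0
  · rw [hab', zero_mul] at key
    have hb1 : (b : D) = 1 := (sub_eq_zero.1 key.symm)
    rw [hb1] at hbw
    apply hne
    have : y * x + x = x * y + x := by simpa [mul_add, add_mul] using hbw
    exact (add_right_cancel this).symm
  · have h3 : ((a : D) - b) * (x * y - y * x) = 0 := by
      have : ((a : D) - b) * (x * y - y * x) = x * (((a : D) - b) * y) - ((a : D) - b) * y * x
          + ((a : D) * x - x * a) * y - ((b : D) * x - x * b) * y := by noncomm_ring
      rw [this, key, hxa, hxb]
      simp [mul_sub, sub_mul, hxb]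
    exact hne (sub_eq_zero.1 ((mul_eq_zero.1 h3).resolve_left hab'))

open Polynomial in
theorem hua_step {D : Type*} [DivisionRing D] (N : Subgroup Dˣ) [N.Normal]
    (hcl : ∀ x ∈ N, ∀ y ∈ N, x * y * x⁻¹ * y⁻¹ ∈ Subgroup.center Dˣ)
    (x : Dˣ) (hx : x ∈ N) (y : D) (l t : Subring.center D) (hl1 : l ≠ 1) (hy0 : y ≠ 0)
    (ht : t ≠ 0) (hxy : (x : D) * y = l * y * x) :
    ∃ k : Subring.center D, (l : D) ^ 2 * t ^ 2 * y ^ 2 + k * y + 1 = 0 := by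
  have cen : ∀ z : Subring.center D, ∀ d : D, d * z = z * d := fun z d =>
    (Subring.mem_center_iff.1 z.2 d)
  have hne : (x : D) * y ≠ y * x := by
    rw [hxy]
    intro h
    have : ((l : D) - 1) * (y * x) = 0 := by rw [sub_mul, ← mul_assoc, h]; simp
    rcases mul_eq_zero.1 this with h | h
    · exact hl1 (Subtype.ext (by simpa using sub_eq_zero.1 h))
    · exact (mul_ne_zero hy0 x.ne_zero) h
  obtain ⟨Y, hY⟩ : ∃ Y : D, Y = t * y := ⟨_, rfl⟩
  have hxY : (x : D) * Y = l * Y * x := by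
    rw [hY, ← mul_assoc, cen t x, mul_assoc, hxy, ← mul_assoc, ← mul_assoc, ← mul_assoc, cen l t]
  have hY1 : Y + 1 ≠ 0 := by
    intro h
    apply hne
    have h1 : Y = -1 := eq_neg_of_add_eq_zero_left h
    have h2 : (t : D) * (x * y - y * x) = 0 := by
      have : (t : D) * (x * y - y * x) = x * Y - Y * x := by
        rw [hY, mul_sub, ← mul_assoc, ← cen t x]; noncomm_ring
      rw [this, h1]; simp
    exact sub_eq_zero.1 ((mul_eq_zero.1 h2).resolve_left (by simpa using ht))
  set w := Units.mk0 (Y + 1) hY1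
  have hbN : x * w * x⁻¹ * w⁻¹ ∈ N := by
    have := N.mul_mem hx (Subgroup.Normal.conj_mem ‹N.Normal› _ (N.inv_mem hx) w)
    simpa [mul_assoc] using this
  set b := x * w * x⁻¹ * w⁻¹ with hb
  have hbw : (b : D) * (Y + 1) * x = x * (Y + 1) := by
    have : b * w * x = x * w := by rw [hb]; group
    have := congrArg (Units.val) this
    simpa [w] using this
  have hbY : (b : D) * (Y + 1) = l * Y + 1 := by
    have h1 : ((b : D) * (Y + 1) - (l * Y + 1)) * x = 0 := by
      rw [sub_mul, hbw, mul_add, hxY]; noncomm_ring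
    exact sub_eq_zero.1 ((mul_eq_zero.1 h1).resolve_right x.ne_zero)
  obtain ⟨nu, hnu⟩ : ∃ nu : Subring.center D, (x : D) * b = nu * b * x := by
    have h1 := hcl x hx b hbN
    refine ⟨⟨((x * b * x⁻¹ * b⁻¹ : Dˣ) : D), ?_⟩, ?_⟩
    · rw [Subring.mem_center_iff]
      intro d
      by_cases hd : d = 0
      · simp [hd]
      · have := Subgroup.mem_center_iff.1 h1 (Units.mk0 d hd)
        have := congrArg Units.val this
        simpa using this
    · have : x * b = (x * b * x⁻¹ * b⁻¹) * b * x := by group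
      have := congrArg Units.val this
      simpa using this
  -- b commutes with Y
  have hcomm : (b : D) * Y = Y * b := by
    have h1 : ((b : D) * Y - Y * b) * (Y + 1) = 0 := by
      have e : ((b : D) * Y - Y * b) * (Y + 1) = b * (Y + 1) * Y - Y * (b * (Y + 1)) := by
        noncomm_ring
      rw [e, hbY, mul_add, add_mul, ← mul_assoc Y, cen l Y]; noncomm_ring
    exact sub_eq_zero.1 ((mul_eq_zero.1 h1).resolve_right hY1)
  have hE : (nu : D) * b * (l * Y + 1) = l ^ 2 * Y + 1 := by
    have h1 : ((nu : D) * b * (l * Y + 1) - (l ^ 2 * Y + 1)) * x = 0 := by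
      have e1 : (nu : D) * b * (l * Y + 1) * x = x * (b * (Y + 1)) := by
        rw [← mul_assoc (x : D), hnu, mul_assoc _ (x : D), mul_add (x : D), hxY]; noncomm_ring
      rw [sub_mul, e1, hbY, mul_add, ← mul_assoc, cen l x, mul_assoc (l : D), hxY]; noncomm_ring
    exact sub_eq_zero.1 ((mul_eq_zero.1 h1).resolve_right x.ne_zero)
  have hF : ((l : D) ^ 2 * Y + 1) * (Y + 1) = nu * (l * Y + 1) ^ 2 := by
    rw [← hE]
    have hb2 : (b : D) * (l * Y + 1) = (l * Y + 1) * b := by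
      rw [mul_add, add_mul, ← mul_assoc, cen l b, mul_assoc, hcomm, mul_assoc]; simp
    rw [mul_assoc (nu : D), hb2, mul_assoc, mul_assoc, hbY, pow_two]
  have hpoly : ∀ p q : (Subring.center D)[X], p = q → aeval y p = aeval y q :=
    fun p q h => by rw [h]
  have hG : (1 - nu : D) * (l ^ 2 * t ^ 2 * y ^ 2) + ((l - 1) ^ 2 + 2 * (1 - nu) * l) * t * y
      + (1 - nu) = 0 := by
    have := hpoly ((1 - C nu) * (C l ^ 2 * C t ^ 2 * X ^ 2) +
      ((C l - 1) ^ 2 + 2 * (1 - C nu) * C l) * C t * X + (1 - C nu))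
      ((C l ^ 2 * (C t * X) + 1) * (C t * X + 1) - C nu * (C l * (C t * X) + 1) ^ 2) (by ring)
    simp only [map_add, map_sub, map_mul, map_pow, aeval_C, aeval_X, map_one, map_ofNat] at this
    change (1 - nu : D) * (l ^ 2 * t ^ 2 * y ^ 2) + ((l - 1) ^ 2 + 2 * (1 - nu) * l) * t * y
      + (1 - nu) = ((l : D) ^ 2 * (t * y) + 1) * (t * y + 1) - nu * (l * (t * y) + 1) ^ 2 at this
    rw [this, ← hY, hF, sub_self]
  have hnu1 : (1 - nu : Subring.center D) ≠ 0 := by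
    intro h
    have h' : (1 - nu : D) = 0 := by
      have := congrArg Subtype.val h; simpa using this
    rw [h'] at hG
    simp only [zero_mul, mul_zero, add_zero, zero_add, mul_eq_zero] at hG
    rcases hG with (hG | hG) | hG
    · have := pow_eq_zero_iff (two_ne_zero) |>.1 hG
      exact hl1 (Subtype.ext (by simpa using sub_eq_zero.1 this))
    · exact ht (by simpa using hG)
    · exact hy0 hG
  refine ⟨(1 - nu)⁻¹ * (((l - 1) ^ 2 + 2 * (1 - nu) * l) * t), ?_⟩
  have hinv : (((1 - nu)⁻¹ : Subring.center D) : D) * (1 - nu : D) = 1 := by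
    have := congrArg Subtype.val (inv_mul_cancel₀ hnu1)
    simpa using this
  have := congrArg (fun z => (((1 - nu)⁻¹ : Subring.center D) : D) * z) hG
  simp only [mul_add, mul_zero, ← mul_assoc, hinv, one_mul] at this
  rw [← this]
  push_cast
  simp only [mul_add, ← mul_assoc, add_mul]
  rfl

theorem hua_solvable (F : Type*) {D : Type*} [Field F] [Infinite F] [DivisionRing D] [Algebra F D]
    [Group.IsSolvable Dˣ] (x y : D) : x * y = y * x := by
  have main : ∀ u : Dˣ, u ∈ Subgroup.center Dˣ := by
    by_contra hcon
    obtain ⟨N, hN, ⟨x, hxN, hxZ⟩, hcl⟩ := exists_derived_step (Subgroup.center Dˣ) hcon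
    by_cases hab : ∀ x ∈ N, ∀ y ∈ N, x * y = y * x
    · apply hxZ
      rw [Subgroup.mem_center_iff]
      intro g
      exact Units.ext (by simpa using (hua_abelian N hab x hxN g).symm)
    · push Not at hab
      obtain ⟨x, hx, y, hy, hne⟩ := hab
      have hlc := hcl x hx y hy
      obtain ⟨l, hl⟩ : ∃ l : Subring.center D, (l : D) = ((x * y * x⁻¹ * y⁻¹ : Dˣ) : D) := by
        refine ⟨⟨((x * y * x⁻¹ * y⁻¹ : Dˣ) : D), ?_⟩, rfl⟩
        rw [Subring.mem_center_iff]
        intro d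
        by_cases hd : d = 0
        · simp [hd]
        · have := Subgroup.mem_center_iff.1 hlc (Units.mk0 d hd)
          have := congrArg Units.val this
          simpa using this
      have hxy : (x : D) * y = l * y * x := by
        rw [hl]
        have : x * y = (x * y * x⁻¹ * y⁻¹) * y * x := by group
        have := congrArg Units.val this
        simpa using this
      have hl1 : l ≠ 1 := by
        rintro rfl
        apply hne
        apply Units.ext
        simpa using hxy
      classical
      obtain ⟨s, hs⟩ : ∃ s : F, s ∉ ({0, 1, -1} : Finset F) := Infinite.exists_notMem_finset _
      simp only [Finset.mem_insert, Finset.mem_singleton, not_or] at hs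
      let t : Subring.center D := ⟨algebraMap F D s, by
        rw [Subring.mem_center_iff]; intro d; exact (Algebra.commutes s d).symm⟩
      have ht : t ≠ 0 := by
        intro h
        have := congrArg Subtype.val h
        exact hs.1 (by simpa [t] using this)
      obtain ⟨k1, hk1⟩ := hua_step N hcl x hx y l 1 hl1 y.ne_zero one_ne_zero hxy
      obtain ⟨k2, hk2⟩ := hua_step N hcl x hx y l t hl1 y.ne_zero ht hxy
      have cen : ∀ z : Subring.center D, ∀ d : D, d * z = z * d := fun z d =>
        (Subring.mem_center_iff.1 z.2 d)
      have e : ((k2 - t ^ 2 * k1 : Subring.center D) : D) * y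
          = ((t ^ 2 - 1 : Subring.center D) : D) := by
        have h1 : (t : D) ^ 2 * ((l : D) ^ 2 * ((1 : Subring.center D) : D) ^ 2 * y ^ 2
          + k1 * y + 1) = 0 := by
          rw [hk1, mul_zero]
        have h2 : (t : D) ^ 2 * (l : D) ^ 2 = l ^ 2 * t ^ 2 :=
          ((show Commute (l : D) t from cen t l).pow_pow 2 2).symm
        have h3 : (t : D) ^ 2 * ((l : D) ^ 2 * ((1 : Subring.center D) : D) ^ 2 * y ^ 2
          + k1 * y + 1) = (l : D) ^ 2 * t ^ 2 * y ^ 2 + t ^ 2 * k1 * y + t ^ 2 := by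
          rw [← h2]; push_cast; noncomm_ring
        rw [h3] at h1
        have h4 := sub_eq_zero.2 (hk2.trans h1.symm)
        push_cast
        rw [← sub_eq_zero, ← h4]
        noncomm_ring
      set c := k2 - t ^ 2 * k1
      have ht2 : (t ^ 2 - 1 : Subring.center D) ≠ 0 := by
        intro h
        have h1 : (s ^ 2 - 1 : F) = 0 := by
          have := congrArg Subtype.val h
          apply (algebraMap F D).injective
          simpa [t] using this
        have h2 : (s - 1) * (s + 1) = 0 := by linear_combination h1
        rcases mul_eq_zero.1 h2 with h | h
        · exact hs.2.1 (sub_eq_zero.1 h)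
        · exact hs.2.2 (eq_neg_of_add_eq_zero_left h)
      have hc : (c : D) ≠ 0 := by
        intro h
        rw [h, zero_mul] at e
        exact ht2 (Subtype.ext (by simpa using e.symm))
      apply hne
      apply Units.ext
      have h5 : (c : D) * (x * y - y * x) = 0 := by
        rw [mul_sub, ← mul_assoc, ← mul_assoc, ← cen c x, mul_assoc, e, ← cen _ (x : D), sub_self]
      exact sub_eq_zero.1 ((mul_eq_zero.1 h5).resolve_left hc)
  by_cases hx : x = 0
  · simp [hx]
  by_cases hy : y = 0
  · simp [hy]
  have := Subgroup.mem_center_iff.1 (main (Units.mk0 y hy)) (Units.mk0 x hx)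
  simpa using congrArg Units.val this

end PartOne

section PartTwo
variable {K V : Type*} [DivisionRing K] [AddCommGroup V] [Module K V]

/-- The group generated by all transvections. -/
def Eg (K V : Type*) [DivisionRing K] [AddCommGroup V] [Module K V] :
    Subgroup (Module.End K V)ˣ :=
  Subgroup.closure {g | ∃ (φ : V →ₗ[K] K) (v : V), φ v = 0 ∧
    ∀ x, (g : Module.End K V) x = x + φ x • v}

/-- A single transvection. -/
def Tv (φ : V →ₗ[K] K) (v : V) (h : φ v = 0) : (Module.End K V)ˣ where
  val := 1 + φ.smulRight v
  inv := 1 - φ.smulRight v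
  val_inv := by ext x; simp [h]
  inv_val := by ext x; simp [h]

lemma Tv_apply (φ : V →ₗ[K] K) (v : V) (h : φ v = 0) (x : V) :
    (Tv φ v h : Module.End K V) x = x + φ x • v := by simp [Tv]

lemma Tv_mem (φ : V →ₗ[K] K) (v : V) (h : φ v = 0) : Tv φ v h ∈ Eg K V :=
  Subgroup.subset_closure ⟨φ, v, h, Tv_apply φ v h⟩

lemma un_ext {g h : (Module.End K V)ˣ}
    (H : ∀ x, (g : Module.End K V) x = (h : Module.End K V) x) : g = h := by
  apply Units.ext; ext x; exact H x

lemma un_mul (g h : (Module.End K V)ˣ) (x : V) :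
    ((g * h : (Module.End K V)ˣ) : Module.End K V) x = (g : Module.End K V) ((h : Module.End K V) x) := rfl

lemma un_inv_l (g : (Module.End K V)ˣ) (x : V) :
    ((g⁻¹ : (Module.End K V)ˣ) : Module.End K V) ((g : Module.End K V) x) = x := by
  rw [← un_mul]; simp

lemma un_inv_r (g : (Module.End K V)ˣ) (x : V) :
    (g : Module.End K V) (((g⁻¹ : (Module.End K V)ˣ) : Module.End K V) x) = x := by
  rw [← un_mul]; simp

lemma un_inj (g : (Module.End K V)ˣ) {x y : V}
    (h : (g : Module.End K V) x = (g : Module.End K V) y) : x = y := by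
  rw [← un_inv_l g x, h, un_inv_l]

instance Eg_normal : (Eg K V).Normal := by
  constructor
  intro t ht g
  induction ht using Subgroup.closure_induction with
  | mem t ht =>
    obtain ⟨φ, v, h, ht⟩ := ht
    refine Subgroup.subset_closure ⟨φ ∘ₗ ((g⁻¹ : (Module.End K V)ˣ) : Module.End K V), (g : Module.End K V) v, ?_, ?_⟩
    · simp [un_inv_l, h]
    · intro x
      rw [un_mul, un_mul, ht]
      simp [un_inv_r]
  | one => simp
  | mul x y _ _ hx hy =>
    have := mul_mem hx hy
    convert this using 1; group
  | inv x _ hx =>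
    have := inv_mem hx
    convert this using 1; group

lemma dual_pair {p : Submodule K V} {v : V} (hv : v ∉ p) :
    ∃ φ : V →ₗ[K] K, φ v = 1 ∧ ∀ u ∈ p, φ u = 0 := by
  obtain ⟨f, hf, hp⟩ := Submodule.exists_le_ker_of_notMem hv
  refine ⟨f.smulRight (f v)⁻¹, by simp [hf], fun u hu => ?_⟩
  have : f u = 0 := hp hu
  simp [this]

lemma eg_step {U : Submodule K V} {a b : V} (h : a ∉ U ⊔ Submodule.span K {b - a}) :
    ∃ t ∈ Eg K V, (∀ u ∈ U, (t : Module.End K V) u = u) ∧ (t : Module.End K V) a = b := by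
  obtain ⟨φ, h1, h2⟩ := dual_pair h
  have h3 : φ (b - a) = 0 := h2 _ (Submodule.mem_sup_right (Submodule.mem_span_singleton_self _))
  refine ⟨Tv φ (b - a) h3, Tv_mem _ _ _, fun u hu => ?_, ?_⟩
  · rw [Tv_apply, h2 u (Submodule.mem_sup_left hu)]; simp
  · rw [Tv_apply, h1]; simp

lemma mem_sup_sing {U : Submodule K V} {x a : V} :
    x ∈ U ⊔ Submodule.span K {a} ↔ ∃ u ∈ U, ∃ c : K, x = u + c • a := by
  rw [Submodule.mem_sup]
  constructor
  · rintro ⟨u, hu, z, hz, rfl⟩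
    obtain ⟨c, rfl⟩ := Submodule.mem_span_singleton.1 hz
    exact ⟨u, hu, c, rfl⟩
  · rintro ⟨u, hu, c, rfl⟩
    exact ⟨u, hu, c • a, Submodule.mem_span_singleton.2 ⟨c, rfl⟩, rfl⟩

lemma exch {U : Submodule K V} {x y : V} (h : x ∈ U ⊔ Submodule.span K {y}) (hx : x ∉ U) :
    y ∈ U ⊔ Submodule.span K {x} := by
  obtain ⟨u, hu, c, rfl⟩ := mem_sup_sing.1 h
  have hc : c ≠ 0 := by rintro rfl; simp [hu] at hx
  refine mem_sup_sing.2 ⟨-(c⁻¹ • u), neg_mem (U.smul_mem _ hu), c⁻¹, ?_⟩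
  rw [smul_add, smul_smul, inv_mul_cancel₀ hc]; simp

lemma eg_dl {U : Submodule K V} {a b : V} (ha : a ∉ U) (hb : b ∉ U ⊔ Submodule.span K {a}) :
    ∃ t ∈ Eg K V, (∀ u ∈ U, (t : Module.End K V) u = u) ∧ (t : Module.End K V) a = b := by
  apply eg_step
  intro h
  have h1 := exch h ha
  apply hb
  have h2 : a ∈ U ⊔ Submodule.span K {a} :=
    Submodule.mem_sup_right (Submodule.mem_span_singleton_self _)
  have := add_mem h1 h2
  simpa using this

lemma eg_move {U : Submodule K V} {a b : V} (ha : a ∉ U) (hb : b ∉ U)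
    (ht : U ⊔ Submodule.span K {b} ≠ ⊤) :
    ∃ t ∈ Eg K V, (∀ u ∈ U, (t : Module.End K V) u = u) ∧ (t : Module.End K V) a = b := by
  by_cases h : b ∈ U ⊔ Submodule.span K {a}
  swap
  · exact eg_dl ha h
  obtain ⟨w, hw⟩ : ∃ w, w ∉ U ⊔ Submodule.span K {b} := by
    by_contra! hh
    exact ht (eq_top_iff.2 fun x _ => hh x)
  have h1 := exch h hb
  have hw2 : w ∉ U ⊔ Submodule.span K {a} := by
    intro h2
    apply hw
    have : U ⊔ Submodule.span K {a} ≤ U ⊔ Submodule.span K {b} := by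
      rw [sup_le_iff]
      exact ⟨le_sup_left, by simpa using h1⟩
    exact this h2
  have hwU : w ∉ U := fun h => hw (Submodule.mem_sup_left h)
  obtain ⟨t1, ht1, f1, g1⟩ := eg_dl ha hw2
  obtain ⟨t2, ht2, f2, g2⟩ := eg_dl (a := w) (b := b) hwU (fun h => hw (exch h hb))
  refine ⟨t2 * t1, mul_mem ht2 ht1, fun u hu => ?_, ?_⟩
  · rw [un_mul, f1 u hu, f2 u hu]
  · rw [un_mul, g1, g2]

lemma eg_trans (h2 : ∀ v : V, Submodule.span K {v} ≠ ⊤) {a b : V} (ha : a ≠ 0) (hb : b ≠ 0) :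
    ∃ t ∈ Eg K V, (t : Module.End K V) a = b := by
  obtain ⟨t, h, -, h'⟩ := eg_move (U := (⊥ : Submodule K V)) (a := a) (b := b)
    (by simpa using ha) (by simpa using hb) (by simpa using h2 b)
  exact ⟨t, h, h'⟩

lemma eg_fix (g : (Module.End K V)ˣ) (s : Finset V) (hs : Submodule.span K (s : Set V) ≠ ⊤) :
    ∃ e ∈ Eg K V, ∀ x ∈ Submodule.span K (s : Set V),
      ((e * g : (Module.End K V)ˣ) : Module.End K V) x = x := by
  classical
  induction s using Finset.induction_on with
  | empty => exact ⟨1, one_mem _, fun x hx => by simp at hx; simp [hx]⟩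
  | insert x s hx ih =>
    have hins : Submodule.span K ((insert x s : Finset V) : Set V) =
        Submodule.span K (s : Set V) ⊔ Submodule.span K {x} := by
      rw [Finset.coe_insert, Submodule.span_insert, sup_comm]
    rw [hins] at hs ⊢
    by_cases hxs : x ∈ Submodule.span K (s : Set V)
    · have : Submodule.span K (s : Set V) ⊔ Submodule.span K {x} = Submodule.span K (s : Set V) := by
        rw [sup_eq_left]; simpa using hxs
      rw [this] at hs ⊢
      exact ih hs
    · obtain ⟨e, he, h⟩ := ih (fun h => hxs (h ▸ Submodule.mem_top))
      have ha : ((e * g : (Module.End K V)ˣ) : Module.End K V) x ∉ Submodule.span K (s : Set V) := by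
        intro h'
        have := h _ h'
        exact hxs (un_inj _ this ▸ h')
      obtain ⟨t, ht, h3, h4⟩ := eg_move ha hxs hs
      refine ⟨t * e, mul_mem ht he, fun y hy => ?_⟩
      obtain ⟨u, hu, c, rfl⟩ := mem_sup_sing.1 hy
      rw [mul_assoc, un_mul, map_add, map_smul, h u hu, map_add, map_smul, h3 u hu, h4]

variable [Module.Finite K V]

lemma eg_dil (g : (Module.End K V)ˣ) (φ : V →ₗ[K] K) (u : V) (hu : φ u = 1) :
    ∃ e ∈ Eg K V, ∃ c : K, ∀ x, ((e * g : (Module.End K V)ˣ) : Module.End K V) x =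
      x + φ x • (c • u - u) := by
  obtain ⟨s, hs⟩ := (IsNoetherian.noetherian (LinearMap.ker φ) : (LinearMap.ker φ).FG)
  obtain ⟨e, he, h⟩ := eg_fix g s (by
    rw [hs]; intro h
    have : u ∈ LinearMap.ker φ := h ▸ Submodule.mem_top
    rw [LinearMap.mem_ker, hu] at this
    exact one_ne_zero this)
  rw [hs] at h
  set k := e * g
  set c := φ ((k : Module.End K V) u) with hc
  set w := (k : Module.End K V) u - c • u with hw
  have hw0 : φ w = 0 := by simp [hw, hu, hc]
  have hc0 : c ≠ 0 := by
    intro h0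
    have h1 := h w hw0
    have h2 : (k : Module.End K V) u = w := by simp [hw, h0]
    have := un_inj k (h2.trans h1.symm)
    rw [← this, hu] at hw0
    exact one_ne_zero hw0
  have hz : (φ.smulRight c⁻¹) (-w) = 0 := by simp [hw0]
  refine ⟨Tv (φ.smulRight c⁻¹) (-w) hz * e, mul_mem (Tv_mem _ _ _) he, c, fun x => ?_⟩
  have hx : x = (x - φ x • u) + φ x • u := by simp
  have hk : (x - φ x • u) ∈ LinearMap.ker φ := by simp [hu]
  have e1 : (k : Module.End K V) x = x - φ x • u + φ x • (c • u + w) := by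
    conv_lhs => rw [hx]
    rw [map_add, map_smul, h _ hk]
    simp [hw]
  rw [mul_assoc, un_mul, Tv_apply]
  change (k : Module.End K V) x + (φ.smulRight c⁻¹) ((k : Module.End K V) x) • (-w) = _
  rw [e1]
  have : φ (x - φ x • u + φ x • (c • u + w)) = φ x * c := by simp [hu, hw0]
  rw [LinearMap.smulRight_apply, this]
  simp [smul_add, smul_sub, mul_assoc, hc0]
  abel

lemma exists_two (h2 : ∀ v : V, Submodule.span K {v} ≠ ⊤) {u : V} (hu : u ≠ 0) :
    ∃ w : V, ∃ φ ψ : V →ₗ[K] K, φ u = 1 ∧ φ w = 0 ∧ ψ u = 0 ∧ ψ w = 1 := by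
  obtain ⟨w, hw⟩ : ∃ w, w ∉ Submodule.span K {u} := by
    by_contra! hh
    exact h2 u (eq_top_iff.2 fun x _ => hh x)
  obtain ⟨ψ, h3, h4⟩ := dual_pair hw
  have : u ∉ Submodule.span K {w} := by
    intro h
    obtain ⟨c, rfl⟩ := Submodule.mem_span_singleton.1 h
    have := h4 _ (Submodule.mem_span_singleton_self _)
    simp [h3] at this
    simp [this] at hu
  obtain ⟨φ, h5, h6⟩ := dual_pair this
  exact ⟨w, φ, ψ, h5, h6 _ (Submodule.mem_span_singleton_self _),
    h4 _ (Submodule.mem_span_singleton_self _), h3⟩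

lemma exists_ne_zero_v (h2 : ∀ v : V, Submodule.span K {v} ≠ ⊤) : ∃ u : V, u ≠ 0 := by
  by_contra! h
  exact h2 0 (eq_top_iff.2 fun x _ => by simp [h x])

lemma eg_comm (h2 : ∀ v : V, Submodule.span K {v} ≠ ⊤) (g h : (Module.End K V)ˣ) :
    g * h * g⁻¹ * h⁻¹ ∈ Eg K V := by
  obtain ⟨u, hu⟩ := exists_ne_zero_v h2
  obtain ⟨w, φ, ψ, a1, a2, a3, a4⟩ := exists_two h2 hu
  obtain ⟨e, he, c, h3⟩ := eg_dil g φ u a1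
  obtain ⟨f, hf, d, h4⟩ := eg_dil h ψ w a4
  have hcom : (e * g) * (f * h) = (f * h) * (e * g) := by
    apply un_ext
    intro x
    rw [un_mul (e * g), un_mul (f * h), h3, h3, h4, h4]
    simp [a1, a2, a3, a4]
    abel
  rw [← QuotientGroup.eq_one_iff]
  have q1 : ((e * g : (Module.End K V)ˣ) : (Module.End K V)ˣ ⧸ Eg K V) = (g : _ ⧸ Eg K V) := by
    rw [QuotientGroup.mk_mul, (QuotientGroup.eq_one_iff e).2 he, one_mul]
  have q2 : ((f * h : (Module.End K V)ˣ) : (Module.End K V)ˣ ⧸ Eg K V) = (h : _ ⧸ Eg K V) := by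
    rw [QuotientGroup.mk_mul, (QuotientGroup.eq_one_iff f).2 hf, one_mul]
  have := congrArg (fun z : (Module.End K V)ˣ => (z : (Module.End K V)ˣ ⧸ Eg K V)) hcom
  simp only [QuotientGroup.mk_mul] at this q1 q2
  rw [q1, q2] at this
  rw [QuotientGroup.mk_mul, QuotientGroup.mk_mul, QuotientGroup.mk_mul, this]
  simp

end PartTwo

section PartThree
open scoped commutatorElement
variable {K V : Type*} [DivisionRing K] [AddCommGroup V] [Module K V]

lemma dil_aux (φ : V →ₗ[K] K) (v : V) (h : φ v = 1) (c d : K) (hcd : d * c = 1) :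
    (1 + φ.smulRight ((c - 1) • v) : Module.End K V) * (1 + φ.smulRight ((d - 1) • v)) = 1 := by
  ext x
  simp only [Module.End.mul_apply, LinearMap.add_apply, Module.End.one_apply,
    LinearMap.smulRight_apply, map_add, map_smul, h, smul_smul, mul_one, mul_sub, smul_add]
  rw [add_assoc, ← add_smul, ← add_smul]
  have : φ x * c - φ x + (φ x * d - φ x + ((φ x * d - φ x) * (1 * c) - (φ x * d - φ x))) = 0 := by
    rw [one_mul, sub_mul, mul_assoc, hcd, mul_one]; abel
  rw [this]; simp

/-- dilation -/
def Dil (φ : V →ₗ[K] K) (v : V) (h : φ v = 1) (a : K) (ha : a ≠ 0) : (Module.End K V)ˣ where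
  val := 1 + φ.smulRight ((a - 1) • v)
  inv := 1 + φ.smulRight ((a⁻¹ - 1) • v)
  val_inv := dil_aux φ v h _ _ (inv_mul_cancel₀ ha)
  inv_val := dil_aux φ v h _ _ (mul_inv_cancel₀ ha)

lemma Dil_apply (φ : V →ₗ[K] K) (v : V) (h : φ v = 1) (a : K) (ha : a ≠ 0) (x : V) :
    (Dil φ v h a ha : Module.End K V) x = x + φ x • ((a - 1) • v) := by simp [Dil]

lemma Dil_inv_apply (φ : V →ₗ[K] K) (v : V) (h : φ v = 1) (a : K) (ha : a ≠ 0) (x : V) :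
    (((Dil φ v h a ha)⁻¹ : (Module.End K V)ˣ) : Module.End K V) x = x + φ x • ((a⁻¹ - 1) • v) := by
  have : (Dil φ v h a ha)⁻¹ = Dil φ v h a⁻¹ (inv_ne_zero ha) := by
    apply Units.ext; rfl
  rw [this, Dil_apply]

variable [Module.Finite K V]

lemma eg_perfect_gen (h2 : ∀ v : V, Submodule.span K {v} ≠ ⊤) {a : K} (ha : a ≠ 0)
    (ha2 : a * a ≠ 1) (φ : V →ₗ[K] K) (v : V) (hv : φ v = 0) :
    Tv φ v hv ∈ ⁅Eg K V, Eg K V⁆ := by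
  by_cases hv0 : v = 0
  · have : Tv φ v hv = 1 := by apply un_ext; intro x; rw [Tv_apply]; simp [hv0]
    rw [this]; exact one_mem _
  by_cases hφ : φ = 0
  · have : Tv φ v hv = 1 := by apply un_ext; intro x; rw [Tv_apply]; simp [hφ]
    rw [this]; exact one_mem _
  obtain ⟨w, hw⟩ : ∃ w, φ w = 1 := by
    obtain ⟨w, hw⟩ : ∃ w, φ w ≠ 0 := by
      by_contra! h
      exact hφ (LinearMap.ext h)
    exact ⟨(φ w)⁻¹ • w, by simp [hw]⟩
  obtain ⟨ψ, p1, p2⟩ := dual_pair (p := Submodule.span K {w}) (v := v) (by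
    intro h
    obtain ⟨c, rfl⟩ := Submodule.mem_span_singleton.1 h
    simp [hw] at hv
    simp [hv] at hv0)
  have p2 := p2 w (Submodule.mem_span_singleton_self _)
  have kinv : (1 - (ψ - φ).smulRight (v - w) : Module.End K V) *
      (1 - (ψ - φ).smulRight (v - w)) = 1 := by
    ext x
    simp [hv, hw, p1, p2, smul_sub, sub_smul, add_smul, smul_add]
    abel
  let k : (Module.End K V)ˣ := ⟨_, _, kinv, kinv⟩
  have kap : ∀ x, (k : Module.End K V) x = x - (ψ x - φ x) • (v - w) := by intro x; simp [k]
  let s := Dil ψ v p1 a ha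
  let r := Dil φ w hw a⁻¹ (inv_ne_zero ha)
  have hr : r = k * s⁻¹ * k⁻¹ := by
    rw [eq_mul_inv_iff_mul_eq]
    apply un_ext
    intro x
    rw [un_mul, un_mul, Dil_apply, Dil_inv_apply, kap, kap]
    simp [hv, hw, p1, p2, smul_sub, sub_smul, smul_smul]
    abel
  have hg : s * r ∈ Eg K V := by
    rw [hr, ← mul_assoc, ← mul_assoc]; exact eg_comm h2 s k
  have hd : a * a - 1 ≠ 0 := sub_ne_zero.2 ha2
  set c := (a * a - 1)⁻¹ with hc
  have hv' : φ (c • v) = 0 := by simp [hv]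
  let t' := Tv φ (c • v) hv'
  have key : Tv φ v hv = ⁅s * r, t'⁆ := by
    rw [commutatorElement_def, eq_mul_inv_iff_mul_eq, eq_mul_inv_iff_mul_eq]
    apply un_ext
    intro x
    have hgx : ∀ x, ((s * r : (Module.End K V)ˣ) : Module.End K V) x =
        x + φ x • ((a⁻¹ - 1) • w) + ψ x • ((a - 1) • v) := by
      intro x
      rw [un_mul, Dil_apply, Dil_apply]
      simp [p2]
    have e1 : φ (((s * r : (Module.End K V)ˣ) : Module.End K V) x) = φ x * a⁻¹ := by
      rw [hgx]; simp [hv, hw, mul_sub]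
    have e2 : ((s * r : (Module.End K V)ˣ) : Module.End K V) v = a • v := by
      rw [hgx]; simp [hv, p1, sub_smul]
    generalize s * r = q at *
    rw [un_mul, un_mul, un_mul, Tv_apply, Tv_apply, Tv_apply, map_add (φ), e1, map_smul, map_smul, hv]
    rw [map_add, map_smul, map_smul]
    rw [e2, add_assoc]
    congr 1
    simp only [smul_smul, smul_zero, smul_eq_mul, mul_zero, add_zero, ← add_smul]
    congr 1
    have e3 : a⁻¹ * c + a⁻¹ = c * a := by
      have e4 : (c * (a * a - 1)) = 1 := inv_mul_cancel₀ hd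
      have e5 : a * c = c * a := by
        have : Commute a (a * a - 1) := by
          unfold Commute SemiconjBy; noncomm_ring
        exact this.inv_right₀
      have e6 : c + 1 = a * (c * a) := by
        rw [← mul_assoc, e5, mul_assoc]
        rw [mul_sub, mul_one] at e4
        rw [← e4]; abel
      rw [← mul_one (a⁻¹), mul_assoc, ← mul_add, one_mul, e6, ← mul_assoc, inv_mul_cancel₀ ha, one_mul]
    rw [mul_assoc, ← mul_add, e3]
  rw [key]
  exact Subgroup.commutator_mem_commutator hg (Tv_mem _ _ _)

lemma eg_perfect (h2 : ∀ v : V, Submodule.span K {v} ≠ ⊤) {a : K} (ha : a ≠ 0)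
    (ha2 : a * a ≠ 1) : Eg K V ≤ ⁅Eg K V, Eg K V⁆ := by
  unfold Eg
  rw [Subgroup.closure_le]
  rintro g ⟨φ, v, hv, hg⟩
  have : g = Tv φ v hv := by apply un_ext; intro x; rw [hg, Tv_apply]
  rw [this]
  exact eg_perfect_gen h2 ha ha2 φ v hv

lemma eg_nontrivial (h2 : ∀ v : V, Submodule.span K {v} ≠ ⊤) : ∃ g ∈ Eg K V, g ≠ 1 := by
  obtain ⟨u, hu⟩ := exists_ne_zero_v h2
  obtain ⟨w, φ, ψ, a1, a2, a3, a4⟩ := exists_two h2 hu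
  refine ⟨Tv φ w a2, Tv_mem _ _ _, fun h => ?_⟩
  have := Tv_apply φ w a2 u
  rw [h] at this
  simp [a1] at this
  simp [this] at a4

lemma eg_not_solvable (h2 : ∀ v : V, Submodule.span K {v} ≠ ⊤) {a : K} (ha : a ≠ 0)
    (ha2 : a * a ≠ 1) (H : Subgroup (Module.End K V)ˣ) (hH : Eg K V ≤ H) :
    ¬ Group.IsSolvable H := by
  intro hs
  have : Group.IsSolvable (Eg K V) :=
    Group.isSolvable_of_isSolvable_injective (f := Subgroup.inclusion hH) (Subgroup.inclusion_injective hH)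
  obtain ⟨g, hg, hg1⟩ := eg_nontrivial h2
  have : Nontrivial (Eg K V) := ⟨⟨g, hg⟩, 1, fun h => hg1 (congrArg Subtype.val h)⟩
  have h1 := Group.IsSolvable.commutator_lt_top_of_nontrivial (Eg K V)
  apply h1.ne
  rw [eq_top_iff]
  rintro ⟨x, hx⟩ -
  have h3 := eg_perfect h2 ha ha2 hx
  rw [← Subgroup.map_subtype_commutator] at h3
  obtain ⟨y, hy, hyx⟩ := h3
  have : y = ⟨x, hx⟩ := Subtype.ext hyx
  exact this ▸ hy

lemma eg_T1 (h2 : ∀ v : V, Submodule.span K {v} ≠ ⊤) {a : K} (ha : a ≠ 0)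
    (ha2 : a * a ≠ 1) (H : Subgroup (Module.End K V)ˣ)
    (hN : ∀ e ∈ Eg K V, ∀ h ∈ H, e * h * e⁻¹ ∈ H) (h0 : (Module.End K V)ˣ) (hh0 : h0 ∈ H) (v0 : V)
    (hv0 : (h0 : Module.End K V) v0 ∉ Submodule.span K {v0}) : Eg K V ≤ H := by
  have v0ne : v0 ≠ 0 := by rintro rfl; simp at hv0
  have hN' : ∀ e ∈ Eg K V, ∀ h ∈ H, e⁻¹ * h * e ∈ H := by
    intro e he h hh
    have := hN e⁻¹ (inv_mem he) h hh
    rwa [inv_inv] at this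
  have move : ∀ a b : V, a ≠ 0 → b ≠ 0 → ∃ k ∈ H, ∃ c : K, (k : Module.End K V) a = c • b := by
    intro a b ha hb
    by_cases hba : b ∈ Submodule.span K {a}
    · obtain ⟨c, rfl⟩ := Submodule.mem_span_singleton.1 hba
      have hc : c ≠ 0 := by rintro rfl; simp at hb
      exact ⟨1, one_mem _, c⁻¹, by simp [smul_smul, hc]⟩
    obtain ⟨e, he, hea⟩ := eg_trans h2 v0ne ha
    set y := (e : Module.End K V) ((h0 : Module.End K V) v0) with hy
    have h1 : ((e * h0 * e⁻¹ : (Module.End K V)ˣ) : Module.End K V) a = y := by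
      rw [un_mul, un_mul, ← hea, un_inv_l]
    have hya : y ∉ Submodule.span K {a} := by
      intro h
      obtain ⟨c, hc⟩ := Submodule.mem_span_singleton.1 h
      rw [← hea, hy, ← map_smul] at hc
      exact hv0 (Submodule.mem_span_singleton.2 ⟨c, un_inj e hc⟩)
    obtain ⟨t, ht, c, f1, f2⟩ : ∃ t ∈ Eg K V, ∃ c : K, (t : Module.End K V) a = a ∧
        (t : Module.End K V) y = c • b := by
      by_cases hb2 : b ∈ Submodule.span K {a} ⊔ Submodule.span K {y}
      · obtain ⟨u, hu, d, hd⟩ := mem_sup_sing.1 hb2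
        have hd0 : d ≠ 0 := by rintro rfl; simp at hd; exact hba (hd ▸ hu)
        obtain ⟨t, ht, g1, g2⟩ := eg_step (U := Submodule.span K {a}) (a := y) (b := d⁻¹ • b) (by
          have : d⁻¹ • b - y = d⁻¹ • u := by
            rw [hd, smul_add, smul_smul, inv_mul_cancel₀ hd0]; simp
          rw [this]
          intro h
          apply hya
          have h3 : Submodule.span K {a} ⊔ Submodule.span K {d⁻¹ • u} ≤ Submodule.span K {a} := by
            rw [sup_le_iff]
            refine ⟨le_rfl, ?_⟩
            rw [Submodule.span_singleton_le_iff_mem]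
            exact Submodule.smul_mem _ _ hu
          exact h3 h)
        exact ⟨t, ht, d⁻¹, g1 a (Submodule.mem_span_singleton_self _), g2⟩
      · obtain ⟨t, ht, g1, g2⟩ := eg_dl hya hb2
        exact ⟨t, ht, 1, g1 a (Submodule.mem_span_singleton_self _), by simpa using g2⟩
    refine ⟨t * (e * h0 * e⁻¹) * t⁻¹, hN t ht _ (hN e he _ hh0), c, ?_⟩
    have f3 : ((t⁻¹ : (Module.End K V)ˣ) : Module.End K V) a = a := by
      conv_lhs => rw [← f1]
      rw [un_inv_l]
    rw [un_mul, un_mul, f3, h1, f2]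
  -- factorisation
  have fact : ∀ x ∈ Eg K V, ∃ φ : V →ₗ[K] K, ∃ hφ : φ v0 = 0, ∃ h ∈ H, x = Tv φ v0 hφ * h := by
    intro x hx
    have Tmul : ∀ (φ ψ : V →ₗ[K] K) (h1 : φ v0 = 0) (h2 : ψ v0 = 0),
        Tv φ v0 h1 * Tv ψ v0 h2 = Tv (φ + ψ) v0 (by simp [h1, h2]) := by
      intro φ ψ h1 h2
      apply un_ext; intro x
      rw [un_mul, Tv_apply, Tv_apply, Tv_apply]
      simp [h1, add_smul]; abel
    have Tinv : ∀ (φ : V →ₗ[K] K) (h1 : φ v0 = 0), (Tv φ v0 h1)⁻¹ = Tv (-φ) v0 (by simp [h1]) := by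
      intro φ h1
      rw [inv_eq_iff_mul_eq_one, Tmul]
      apply un_ext; intro x
      rw [Tv_apply]; simp
    induction hx using Subgroup.closure_induction with
    | mem t ht =>
      obtain ⟨φ, w, h, ht⟩ := ht
      by_cases hw : w = 0
      · refine ⟨0, by simp, 1, one_mem _, ?_⟩
        apply un_ext; intro x
        rw [un_mul, Tv_apply, ht]; simp [hw]
      obtain ⟨k, hk, c, hkc⟩ := move w v0 hw v0ne
      let φ' : V →ₗ[K] K := (φ ∘ₗ ((k⁻¹ : (Module.End K V)ˣ) : Module.End K V)).smulRight c
      have hφ' : φ' v0 = 0 := by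
        have hc : c ≠ 0 := by
          rintro rfl
          have : (k : Module.End K V) w = (k : Module.End K V) 0 := by rw [hkc]; simp
          exact hw (un_inj k this)
        have : ((k⁻¹ : (Module.End K V)ˣ) : Module.End K V) v0 = c⁻¹ • w := by
          apply un_inj k
          rw [un_inv_r, map_smul, hkc, smul_smul, inv_mul_cancel₀ hc, one_smul]
        simp [φ', this, h]
      have e1 : k * t = Tv φ' v0 hφ' * k := by
        apply un_ext; intro x
        rw [un_mul, un_mul, ht, Tv_apply]
        simp [φ', un_inv_l, hkc, smul_smul]
      refine ⟨φ', hφ', (Tv φ' v0 hφ')⁻¹ * k⁻¹ * Tv φ' v0 hφ' * k,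
        mul_mem (hN' _ (Tv_mem _ _ _) _ (inv_mem hk)) hk, ?_⟩
      rw [mul_assoc _ (Tv φ' v0 hφ') k, ← e1]; group
    | one =>
      refine ⟨0, by simp, 1, one_mem _, ?_⟩
      apply un_ext; intro x
      rw [un_mul, Tv_apply]; simp
    | mul x y _ _ hx hy =>
      obtain ⟨φ, hφ, h, hh, rfl⟩ := hx
      obtain ⟨ψ, hψ, h', hh', rfl⟩ := hy
      refine ⟨φ + ψ, by simp [hφ, hψ], (Tv ψ v0 hψ)⁻¹ * h * Tv ψ v0 hψ * h',
        mul_mem (hN' _ (Tv_mem _ _ _) _ hh) hh', ?_⟩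
      rw [← Tmul φ ψ hφ hψ]; group
    | inv x _ hx =>
      obtain ⟨φ, hφ, h, hh, rfl⟩ := hx
      refine ⟨-φ, by simp [hφ], Tv φ v0 hφ * h⁻¹ * (Tv φ v0 hφ)⁻¹,
        hN _ (Tv_mem _ _ _) _ (inv_mem hh), ?_⟩
      rw [← Tinv φ hφ]; group
  refine (eg_perfect h2 ha ha2).trans ?_
  rw [Subgroup.commutator_le]
  intro x hx y hy
  obtain ⟨φ, hφ, h, hh, rfl⟩ := fact x hx
  obtain ⟨ψ, hψ, h', hh', rfl⟩ := fact y hy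
  have cm : Tv φ v0 hφ * Tv ψ v0 hψ = Tv ψ v0 hψ * Tv φ v0 hφ := by
    apply un_ext; intro x
    rw [un_mul, un_mul, Tv_apply, Tv_apply, Tv_apply, Tv_apply]
    simp [hφ, hψ]; abel
  have m1 : Tv φ v0 hφ ∈ Eg K V := Tv_mem _ _ _
  have m2 : Tv ψ v0 hψ ∈ Eg K V := Tv_mem _ _ _
  generalize Tv φ v0 hφ = p at *
  generalize Tv ψ v0 hψ = q at *
  have : ⁅p * h, q * h'⁆ = (p * h * p⁻¹) * ((p * q) * (h' * h⁻¹) * (p * q)⁻¹) * (q * h'⁻¹ * q⁻¹) := by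
    rw [commutatorElement_def]
    have e : q⁻¹ * p⁻¹ * q = p⁻¹ := by
      rw [← mul_inv_rev, cm, mul_inv_rev, mul_assoc]; simp
    calc _ = p * h * q * h' * h⁻¹ * p⁻¹ * h'⁻¹ * q⁻¹ := by group
      _ = p * h * q * h' * h⁻¹ * (q⁻¹ * p⁻¹ * q) * h'⁻¹ * q⁻¹ := by rw [e]
      _ = _ := by group
  rw [this]
  exact mul_mem (mul_mem (hN p m1 _ hh) (hN _ (mul_mem m1 m2) _ (mul_mem hh' (inv_mem hh))))
    (hN q m2 _ (inv_mem hh'))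

lemma scalar_of_span (h2 : ∀ v : V, Submodule.span K {v} ≠ ⊤) (g : Module.End K V)
    (hg : ∀ v, g v ∈ Submodule.span K {v}) :
    ∃ c : K, (∀ x, c * x = x * c) ∧ ∀ v, g v = c • v := by
  obtain ⟨c, hc⟩ := LinearMap.exists_mem_center_apply_eq_smul_of_forall_notLinearIndependent
    (f := g) (by
      intro h
      obtain ⟨v, hv, hv'⟩ := finrank_eq_one_iff'.1 h
      exact h2 v (eq_top_iff.2 fun x _ => Submodule.mem_span_singleton.2 (hv' x))) (by
      intro v h
      rw [LinearIndependent.pair_iff] at h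
      obtain ⟨c, hc⟩ := Submodule.mem_span_singleton.1 (hg v)
      have := h c (-1) (by rw [hc]; simp)
      simp at this)
  refine ⟨c, fun x => ((Subring.mem_center_iff.1 c.2) x).symm, fun v => ?_⟩
  rw [hc]; rfl

lemma subring_top_of_eg (h2 : ∀ v : V, Submodule.span K {v} ≠ ⊤) (S : Subring (Module.End K V))
    (hS : ∀ e ∈ Eg K V, (e : Module.End K V) ∈ S) : S = ⊤ := by
  have r0 : ∀ (φ : V →ₗ[K] K) (v : V), φ v = 0 → φ.smulRight v ∈ S := by
    intro φ v h
    have h1 := hS _ (Tv_mem φ v h)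
    have := S.sub_mem h1 S.one_mem
    simpa [Tv] using this
  have r1 : ∀ (φ : V →ₗ[K] K) (v : V), φ.smulRight v ∈ S := by
    intro φ v
    by_cases h : φ v = 0
    · exact r0 φ v h
    obtain ⟨u, hu⟩ : ∃ u, u ∉ Submodule.span K {v} := by
      by_contra! hh
      exact h2 v (eq_top_iff.2 fun x _ => hh x)
    set w := u - (φ u * (φ v)⁻¹) • v with hw
    have hwφ : φ w = 0 := by simp [hw, h]
    have hwv : w ∉ Submodule.span K {v} := by
      intro h'
      apply hu
      have := add_mem h' (Submodule.smul_mem _ (φ u * (φ v)⁻¹) (Submodule.mem_span_singleton_self v))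
      simpa [hw] using this
    obtain ⟨ψ, q1, q2⟩ := dual_pair hwv
    have := S.mul_mem (r0 ψ v (q2 v (Submodule.mem_span_singleton_self v))) (r0 φ w hwφ)
    convert this using 1
    ext x
    simp [q1]
  rw [eq_top_iff]
  intro g _
  let b := Module.finBasis K V
  have : g = ∑ i, (b.coord i).smulRight (g (b i)) := by
    ext x
    have := congrArg g (b.sum_repr x)
    rw [map_sum] at this
    simp only [map_smul] at this
    rw [← this]
    simp
  rw [this]
  exact S.sum_mem fun i _ => r1 _ _

lemma subnormal_eg (h2 : ∀ v : V, Submodule.span K {v} ≠ ⊤) {a : K} (ha : a ≠ 0)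
    (ha2 : a * a ≠ 1) (k : ℕ) (s : ℕ → Subgroup (Module.End K V)ˣ) (hk : s k = ⊤)
    (hs : ∀ i < k, s i ≤ s (i + 1) ∧ ((s i).subgroupOf (s (i + 1))).Normal)
    (h0 : (Module.End K V)ˣ) (hh0 : h0 ∈ s 0) (v0 : V)
    (hv0 : (h0 : Module.End K V) v0 ∉ Submodule.span K {v0}) : Eg K V ≤ s 0 := by
  have mono : ∀ i ≤ k, s 0 ≤ s i := by
    intro i
    induction i with
    | zero => intro _; exact le_rfl
    | succ i ih => intro h; exact (ih (by omega)).trans (hs i (by omega)).1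
  have main : ∀ j ≤ k, Eg K V ≤ s (k - j) := by
    intro j
    induction j with
    | zero => intro _; simp [hk]
    | succ j ih =>
      intro hj
      have h3 := ih (by omega)
      have h4 := hs (k - (j + 1)) (by omega)
      have e : k - (j + 1) + 1 = k - j := by omega
      rw [e] at h4
      refine eg_T1 h2 ha ha2 _ ?_ h0 (mono _ (by omega) hh0) v0 hv0
      intro e he h hh
      have := h4.2.conj_mem ⟨h, h4.1 hh⟩ (by simpa [Subgroup.mem_subgroupOf] using hh) ⟨e, h3 he⟩
      simpa [Subgroup.mem_subgroupOf] using this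
  simpa using main k le_rfl

end PartThree

section PartFour

/-- Matrices as endomorphisms of the column space. -/
noncomputable def matEquiv (F D : Type*) [Field F] [DivisionRing D] [Algebra F D] (d : ℕ) :
    Matrix (Fin d) (Fin d) D ≃ₐ[F] Module.End Dᵐᵒᵖ (Fin d → D) :=
  (AlgEquiv.mapMatrix (m := Fin d) (AlgEquiv.moduleEndSelfOp (A := D) F)).trans
    (endVecAlgEquivMatrixEnd (Fin d) F Dᵐᵒᵖ D).symm

instance finite_op_self (D : Type*) [DivisionRing D] : Module.Finite Dᵐᵒᵖ D :=
  ⟨⟨{1}, by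
    rw [eq_top_iff]
    intro x _
    refine Submodule.mem_span_singleton.2 ?_ |> fun h => by simpa using h
    exact ⟨MulOpposite.op x, by simp⟩⟩⟩

lemma span_ne_top (D : Type*) [DivisionRing D] (d : ℕ) (hd : 2 ≤ d) (v : Fin d → D) :
    Submodule.span Dᵐᵒᵖ {v} ≠ ⊤ := by
  intro h
  have h1 : ∀ x : Fin d → D, ∃ c : D, ∀ i, x i = v i * c := by
    intro x
    obtain ⟨c, hc⟩ := Submodule.mem_span_singleton.1 (h ▸ Submodule.mem_top : x ∈ Submodule.span Dᵐᵒᵖ {v})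
    refine ⟨c.unop, fun i => ?_⟩
    rw [← hc]; simp
  let i0 : Fin d := ⟨0, by omega⟩
  let i1 : Fin d := ⟨1, by omega⟩
  have hne : i0 ≠ i1 := by simp [i0, i1]
  obtain ⟨c, hc⟩ := h1 (Pi.single i0 1)
  obtain ⟨c', hc'⟩ := h1 (Pi.single i1 1)
  have a1 := hc i0
  have a2 := hc i1
  have a3 := hc' i0
  have a4 := hc' i1
  simp [hne, hne.symm] at a1 a2 a3 a4
  rcases a2 with h | h
  · simp [h] at a4
  · simp [h] at a1

lemma exists_a (F K : Type*) [Field F] [Infinite F] [DivisionRing K] [Algebra F K] :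
    ∃ a : K, a ≠ 0 ∧ a * a ≠ 1 := by
  classical
  obtain ⟨a, ha⟩ := Infinite.exists_notMem_finset ({0, 1, -1} : Finset F)
  simp at ha
  refine ⟨algebraMap F K a, ?_, ?_⟩
  · simpa using ha.1
  · rw [← map_mul]
    intro h
    have : a * a = 1 := (algebraMap F K).injective (by simpa using h)
    rcases mul_self_eq_one_iff.1 this with h | h
    · exact ha.2.1 h
    · exact ha.2.2 h

lemma mat_units_comm (F D : Type*) [Field F] [Infinite F] [DivisionRing D] [Algebra F D] (d : ℕ)
    (hs : Group.IsSolvable (Matrix (Fin d) (Fin d) D)ˣ) (x y : Matrix (Fin d) (Fin d) D) :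
    x * y = y * x := by
  by_cases hd : 2 ≤ d
  · exfalso
    obtain ⟨a, ha, ha2⟩ := exists_a F Dᵐᵒᵖ
    have e : (Matrix (Fin d) (Fin d) D)ˣ ≃* (Module.End Dᵐᵒᵖ (Fin d → D))ˣ :=
      Units.mapEquiv (matEquiv F D d : _ ≃* _)
    have : Group.IsSolvable (Module.End Dᵐᵒᵖ (Fin d → D))ˣ :=
      Group.isSolvable_of_surjective (f := e.toMonoidHom) e.surjective
    refine eg_not_solvable (span_ne_top D d hd) ha ha2 ⊤ le_top ?_
    exact Group.isSolvable_of_isSolvable_injective (f := Subgroup.subtype _) Subtype.val_injective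
  · have : d = 0 ∨ d = 1 := by omega
    rcases this with rfl | rfl
    · ext i; exact i.elim0
    · let e : Matrix (Fin 1) (Fin 1) D ≃+* D := Matrix.uniqueRingEquiv
      have e' : (Matrix (Fin 1) (Fin 1) D)ˣ ≃* Dˣ := Units.mapEquiv (e : _ ≃* _)
      have : Group.IsSolvable Dˣ :=
        Group.isSolvable_of_surjective (f := e'.toMonoidHom) e'.surjective
      apply e.injective
      rw [map_mul, map_mul]
      exact hua_solvable F _ _

lemma comm_mem_jacobson (F C : Type*) [Field F] [Infinite F] [Ring C] [Algebra F C]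
    [Module.Finite F C] (hs : Group.IsSolvable Cˣ) (x y : C) :
    x * y - y * x ∈ Ring.jacobson C := by
  have : IsArtinianRing C := IsArtinianRing.of_finite F C
  have hss : IsSemisimpleRing (C ⧸ Ring.jacobson C) := IsSemiprimaryRing.isSemisimpleRing
  obtain ⟨N, hN⟩ := (IsSemiprimaryRing.isNilpotent : IsNilpotent (Ring.jacobson C))
  have unit1 : ∀ j ∈ Ring.jacobson C, IsUnit (1 + j) := by
    intro j hj
    have : IsNilpotent j := ⟨N, by
      have := Ideal.pow_mem_pow hj N
      rw [hN] at this
      simpa using this⟩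
    exact this.isUnit_one_add
  let q := Ideal.Quotient.mk (Ring.jacobson C)
  have hq : Function.Surjective q := Ideal.Quotient.mk_surjective
  have surj1 : Function.Surjective (Units.map (q : C →* C ⧸ Ring.jacobson C)) := by
    intro u
    obtain ⟨a, ha⟩ := hq u
    obtain ⟨b, hb⟩ := hq (u⁻¹ : (C ⧸ Ring.jacobson C)ˣ)
    have h1 : IsUnit (a * b) := by
      have := unit1 (a * b - 1) (Ideal.Quotient.eq_zero_iff_mem.1 (by
        change q (a * b - 1) = 0
        rw [map_sub, map_mul, ha, hb]; simp))
      simpa using this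
    have h2 : IsUnit (b * a) := by
      have := unit1 (b * a - 1) (Ideal.Quotient.eq_zero_iff_mem.1 (by
        change q (b * a - 1) = 0
        rw [map_sub, map_mul, ha, hb]; simp))
      simpa using this
    obtain ⟨p, hp⟩ := h1
    obtain ⟨r, hr⟩ := h2
    have hua : IsUnit a := by
      rw [isUnit_iff_exists_and_exists]
      refine ⟨⟨b * (p⁻¹ : Cˣ), ?_⟩, ⟨(r⁻¹ : Cˣ) * b, ?_⟩⟩
      · rw [← mul_assoc, ← hp]; simp
      · rw [mul_assoc, ← hr]; simp
    obtain ⟨w, hw⟩ := hua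
    refine ⟨w, Units.ext ?_⟩
    simp [hw]
    exact ha
  have s1 : Group.IsSolvable (C ⧸ Ring.jacobson C)ˣ := Group.isSolvable_of_surjective surj1
  obtain ⟨m, D, d, i1, i2, -, ⟨e⟩⟩ :=
    IsSemisimpleRing.exists_algEquiv_pi_matrix_divisionRing F (C ⧸ Ring.jacobson C)
  have key : ∀ z w : C ⧸ Ring.jacobson C, z * w = w * z := by
    intro z w
    apply e.injective
    rw [map_mul, map_mul]
    funext i
    have e1 : (C ⧸ Ring.jacobson C)ˣ ≃* (Π i, (Matrix (Fin (d i)) (Fin (d i)) (D i))ˣ) :=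
      (Units.mapEquiv (e : _ ≃* _)).trans MulEquiv.piUnits
    have s2 : Group.IsSolvable (Matrix (Fin (d i)) (Fin (d i)) (D i))ˣ := by
      refine Group.isSolvable_of_surjective
        (f := (Pi.evalMonoidHom _ i).comp e1.toMonoidHom) ?_
      exact (Function.surjective_eval i).comp e1.surjective
    exact mat_units_comm F (D i) (d i) s2 _ _
  rw [← Ideal.Quotient.eq_zero_iff_mem]
  change q (x * y - y * x) = 0
  rw [map_sub, map_mul, map_mul, key, sub_self]

end PartFour

section PartFive
variable {F K V : Type*} [Field F] [Infinite F] [DivisionRing K] [Algebra F K] [AddCommGroup V]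
  [Module K V] [Module F V] [IsScalarTower F K V] [Module.Finite K V]

/-- units of a subring -/
def UC (C : Subring (Module.End K V)) : Subgroup (Module.End K V)ˣ where
  carrier := {h | (h : Module.End K V) ∈ C ∧ ((h⁻¹ : (Module.End K V)ˣ) : Module.End K V) ∈ C}
  one_mem' := by simp [C.one_mem]
  mul_mem' := by
    rintro a b ⟨h1, h2⟩ ⟨h3, h4⟩
    refine ⟨by simpa using C.mul_mem h1 h3, by simpa using C.mul_mem h4 h2⟩
  inv_mem' := by
    rintro a ⟨h1, h2⟩
    exact ⟨h2, by simpa using h1⟩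

lemma mem_UC {C : Subring (Module.End K V)} {h : (Module.End K V)ˣ} :
    h ∈ UC C ↔ (h : Module.End K V) ∈ C ∧ ((h⁻¹ : (Module.End K V)ˣ) : Module.End K V) ∈ C := Iff.rfl

/-- The standing assumptions. -/
structure Setup (F K V : Type*) [Field F] [Infinite F] [DivisionRing K] [Algebra F K]
    [AddCommGroup V] [Module K V] [Module F V] [IsScalarTower F K V] [Module.Finite K V]
    (G M : Subgroup (Module.End K V)ˣ) : Prop where
  h2 : ∀ v : V, Submodule.span K {v} ≠ ⊤
  hnc : ∃ a b : K, a * b ≠ b * a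
  hcent : ∀ c : K, (∀ x, c * x = x * c) → ∃ f, algebraMap F K f = c
  hlf : ∀ s : Finset (Module.End K V),
    Module.Finite F (Algebra.adjoin F (s : Set (Module.End K V)))
  hEG : Eg K V ≤ G
  hMG : M ≤ G
  hmax : ∀ H : Subgroup (Module.End K V)ˣ, M ≤ H → H ≤ G → H = M ∨ H = G
  hne : M ≠ G
  hsol : Group.IsSolvable M

variable {G M : Subgroup (Module.End K V)ˣ}

lemma sol_UC (S : Setup F K V G M) (C : Subring (Module.End K V)) (hC : UC C ⊓ G ≤ M) :
    Group.IsSolvable (UC C) := by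
  have := S.hsol
  have hm : ∀ x : commutator (UC C), ((x : UC C) : (Module.End K V)ˣ) ∈ M := by
    rintro ⟨x, hx⟩
    apply hC
    refine ⟨x.2, ?_⟩
    have h1 : commutator (UC C) ≤ G.comap (UC C).subtype := by
      rw [commutator_def, Subgroup.commutator_le]
      intro a _ b _
      exact S.hEG (eg_comm S.h2 (a : (Module.End K V)ˣ) b)
    exact h1 hx
  have s1 : Group.IsSolvable (commutator (UC C)) := by
    let f : commutator (UC C) →* M :=
      (((UC C).subtype).comp (commutator (UC C)).subtype).codRestrict M hm
    refine Group.isSolvable_of_isSolvable_injective (f := f) ?_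
    intro x y hxy
    have := congrArg (fun z : M => (z : (Module.End K V)ˣ)) hxy
    exact Subtype.ext (Subtype.ext this)
  refine Group.isSolvable_of_ker_le_range (commutator (UC C)).subtype
    (Abelianization.of (G := UC C)) ?_
  intro x hx
  rw [Abelianization.ker_of] at hx
  exact ⟨⟨x, hx⟩, rfl⟩

lemma comm_jac (S : Setup F K V G M) (C : Subring (Module.End K V)) (hC : UC C ⊓ G ≤ M)
    (C0 : Subalgebra F (Module.End K V)) [Module.Finite F C0] (h0 : ∀ x ∈ C0, x ∈ C) (x y : C0) :
    x * y - y * x ∈ Ring.jacobson C0 := by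
  have := sol_UC S C hC
  apply comm_mem_jacobson F
  let f : C0ˣ →* UC C := (Units.map (C0.val : C0 →* Module.End K V)).codRestrict (UC C) (by
    intro u
    refine mem_UC.2 ⟨h0 _ (u : C0).2, ?_⟩
    rw [← map_inv]
    exact h0 _ ((u⁻¹ : C0ˣ) : C0).2)
  refine Group.isSolvable_of_isSolvable_injective (f := f) ?_
  intro x y hxy
  have h1 := congrArg (fun z : UC C => ((z : (Module.End K V)ˣ) : Module.End K V)) hxy
  exact Units.ext (Subtype.ext h1)

lemma jac_nil (C0 : Subalgebra F (Module.End K V)) [Module.Finite F C0] :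
    IsNilpotent (Ring.jacobson C0) := by
  have : IsArtinianRing C0 := IsArtinianRing.of_finite F C0
  exact IsSemiprimaryRing.isNilpotent

lemma exists_killed (S : Setup F K V G M) (C : Subring (Module.End K V)) (hC : UC C ⊓ G ≤ M)
    (C0 : Subalgebra F (Module.End K V)) [Module.Finite F C0] (h0 : ∀ x ∈ C0, x ∈ C) :
    ∃ v : V, v ≠ 0 ∧ ∀ x ∈ C0, ∀ y ∈ C0, ∀ z ∈ C0, (x * y - y * x) (z v) = 0 := by
  classical
  obtain ⟨u, hu⟩ := exists_ne_zero_v S.h2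
  have hex : ∃ n : ℕ, ∀ j ∈ (Ring.jacobson C0) ^ n, ∀ v : V, (j : Module.End K V) v = 0 := by
    obtain ⟨n, hn⟩ := jac_nil C0
    refine ⟨n, fun j hj v => ?_⟩
    rw [hn] at hj
    have : j = 0 := by simpa using hj
    simp [this]
  have h1 := Nat.find_spec hex
  have hn0 : Nat.find hex ≠ 0 := by
    intro h
    rw [h] at h1
    exact hu (by simpa using h1 1 (by rw [Submodule.pow_zero, Ideal.one_eq_top]; trivial) u)
  obtain ⟨m, hm⟩ := Nat.exists_eq_succ_of_ne_zero hn0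
  have h3 := Nat.find_min hex (m := m) (by omega)
  rw [hm] at h1
  push Not at h3
  obtain ⟨j, hj, v, hv⟩ := h3
  refine ⟨_, hv, fun x hx y hy z hz => ?_⟩
  have c1 := comm_jac S C hC C0 h0 ⟨x, hx⟩ ⟨y, hy⟩
  have c2 : (⟨x, hx⟩ * ⟨y, hy⟩ - ⟨y, hy⟩ * ⟨x, hx⟩ : C0) * ⟨z, hz⟩ ∈ Ring.jacobson C0 :=
    Ideal.mul_mem_right _ _ c1
  have c3 := h1 _ (by
    rw [Nat.succ_eq_add_one, Ideal.IsTwoSided.pow_succ]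
    exact Ideal.mul_mem_mul c2 hj) v
  simpa using c3

lemma irred (S : Setup F K V G M) (W : Submodule K V) (hW : ∀ m ∈ M, ∀ w ∈ W,
    (m : Module.End K V) w ∈ W) : W = ⊥ ∨ W = ⊤ := by
  classical
  by_contra! hcon
  obtain ⟨hb, ht⟩ := hcon
  let C : Subalgebra F (Module.End K V) :=
    { carrier := {x | ∀ w ∈ W, x w ∈ W}
      mul_mem' := fun {a b} ha hb w hw => ha _ (hb _ hw)
      add_mem' := fun {a b} ha hb w hw => W.add_mem (ha _ hw) (hb _ hw)
      algebraMap_mem' := fun r w hw => by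
        rw [Module.algebraMap_end_apply]
        exact W.smul_of_tower_mem r hw }
  obtain ⟨w, hw, hw0⟩ := W.ne_bot_iff.1 hb
  have hM : M ≤ UC C.toSubring ⊓ G := by
    intro m hm
    refine ⟨⟨fun w hw => hW m hm w hw, fun w hw => hW m⁻¹ (inv_mem hm) w hw⟩, S.hMG hm⟩
  rcases S.hmax _ hM inf_le_right with h | h
  · obtain ⟨d, d', hd⟩ := S.hnc
    obtain ⟨φ, h1, -⟩ := dual_pair (p := (⊥ : Submodule K V)) (v := w) (by simpa using hw0)
    set x : Module.End K V := φ.smulRight (d • w)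
    set y : Module.End K V := φ.smulRight (d' • w)
    have hx : x ∈ C := fun u hu => W.smul_mem _ (W.smul_mem _ hw)
    have hy : y ∈ C := fun u hu => W.smul_mem _ (W.smul_mem _ hw)
    have hfin := S.hlf {x, y}
    have h0 : ∀ z ∈ Algebra.adjoin F (({x, y} : Finset (Module.End K V)) : Set (Module.End K V)), z ∈ C.toSubring := by
      intro z hz
      have : Algebra.adjoin F (({x, y} : Finset (Module.End K V)) : Set (Module.End K V)) ≤ C := by
        rw [Algebra.adjoin_le_iff]
        intro z hz
        simp at hz
        rcases hz with rfl | rfl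
        exacts [hx, hy]
      exact this hz
    have c1 := comm_jac S C.toSubring h.le _ h0 ⟨x, Algebra.subset_adjoin (by simp)⟩ ⟨y, Algebra.subset_adjoin (by simp)⟩
    obtain ⟨N, hN⟩ := jac_nil (F := F) (Algebra.adjoin F (({x, y} : Finset (Module.End K V)) : Set (Module.End K V)))
    have c2 := Ideal.pow_mem_pow c1 N
    rw [hN] at c2
    have c3 : (x * y - y * x) ^ N = 0 := by
      have c4 := congrArg Subtype.val ((Submodule.mem_bot _).1 c2)
      simpa using c4
    have c5 : ∀ k : ℕ, ((x * y - y * x) ^ k) w = ((d' * d - d * d') ^ k) • w := by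
      intro k
      induction k with
      | zero => simp
      | succ k ih =>
        have e : (x * y - y * x) w = (d' * d - d * d') • w := by
          rw [LinearMap.sub_apply]
          simp [x, y, h1, smul_smul, sub_smul]
        rw [pow_succ, Module.End.mul_apply, e, map_smul, ih, smul_smul, pow_succ']
    have c6 := c5 N
    rw [c3] at c6
    simp only [LinearMap.zero_apply] at c6
    rw [eq_comm, smul_eq_zero] at c6
    rcases c6 with c6 | c6
    · exact hd (sub_eq_zero.1 (eq_zero_of_pow_eq_zero c6)).symm
    · exact hw0 c6
  · obtain ⟨u, hu⟩ : ∃ u, u ∉ W := by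
      by_contra! hh
      exact ht (eq_top_iff.2 fun x _ => hh x)
    obtain ⟨e, he, hew⟩ := eg_trans S.h2 hw0 (b := u) (by rintro rfl; exact hu W.zero_mem)
    have := h.ge (S.hEG he)
    exact hu (hew ▸ this.1.1 w hw)

lemma exists_shift {A : Type*} [Ring A] [Algebra F A] (c : A) (hc : IsIntegral F c) :
    ∃ (f : F) (u : Aˣ), (u : A) = c - algebraMap F A f ∧ ((u⁻¹ : Aˣ) : A) ∈ Algebra.adjoin F {c} := by
  classical
  have hp : minpoly F c ≠ 0 := minpoly.ne_zero hc
  obtain ⟨f, hf⟩ := Infinite.exists_notMem_finset (minpoly F c).roots.toFinset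
  have hf' : (minpoly F c).eval f ≠ 0 := by
    intro h
    exact hf (by simp [hp, h])
  set r := (minpoly F c).eval f with hr
  set q := (minpoly F c) /ₘ (Polynomial.X - Polynomial.C f) with hq
  have e1 : minpoly F c = Polynomial.C r + (Polynomial.X - Polynomial.C f) * q := by
    conv_lhs => rw [← Polynomial.modByMonic_add_div (minpoly F c) (Polynomial.X - Polynomial.C f)]
    rw [Polynomial.modByMonic_X_sub_C_eq_C_eval]
  have e2 := congrArg (Polynomial.aeval c) e1
  rw [minpoly.aeval] at e2
  simp only [map_add, map_mul, Polynomial.aeval_C, map_sub, Polynomial.aeval_X] at e2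
  have e3 : (c - algebraMap F A f) * (Polynomial.aeval c) (Polynomial.C (-r⁻¹) * q) = 1 := by
    rw [map_mul, Polynomial.aeval_C, ← mul_assoc, ← Algebra.commutes, mul_assoc,
      (eq_neg_of_add_eq_zero_right e2.symm), ← map_neg, ← map_mul]
    simp [hf']
  have e4 : (Polynomial.aeval c) (Polynomial.C (-r⁻¹) * q) * (c - algebraMap F A f) = 1 := by
    rw [← e3]
    have : c - algebraMap F A f = Polynomial.aeval c (Polynomial.X - Polynomial.C f) := by simp
    rw [this, ← map_mul, ← map_mul, mul_comm]
  refine ⟨f, ⟨_, _, e3, e4⟩, rfl, ?_⟩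
  exact Polynomial.aeval_mem_adjoin_singleton F c

lemma isInt (S : Setup F K V G M) (c : Module.End K V) : IsIntegral F c := by
  have := S.hlf {c}
  have h : IsIntegral F (⟨c, Algebra.subset_adjoin (by simp)⟩ :
    Algebra.adjoin F (({c} : Finset (Module.End K V)) : Set (Module.End K V))) := IsIntegral.of_finite F _
  exact h.map (Algebra.adjoin F (({c} : Finset (Module.End K V)) : Set (Module.End K V))).val

/-- being a scalar from `F` -/
def IsSc (F : Type*) {K V : Type*} [Field F] [DivisionRing K] [Algebra F K] [AddCommGroup V]
    [Module K V] [Module F V] [IsScalarTower F K V] (c : Module.End K V) : Prop :=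
  ∃ f : F, algebraMap F (Module.End K V) f = c

lemma isSc_of_span (S : Setup F K V G M) (c : Module.End K V) 
    (h : ∀ v, c v ∈ Submodule.span K {v}) : IsSc F c := by
  obtain ⟨k, hk, hv⟩ := scalar_of_span S.h2 c h
  obtain ⟨f, rfl⟩ := S.hcent k hk
  exact ⟨f, by ext v; rw [hv]; simp⟩

lemma exists_of_not_sc (S : Setup F K V G M) (c : Module.End K V) (h : ¬ IsSc F c) :
    ∃ v, c v ∉ Submodule.span K {v} := by
  by_contra! hh
  exact h (isSc_of_span S c hh)

lemma top_of_normalized (S : Setup F K V G M) (C : Subalgebra F (Module.End K V))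
    (hC : ∀ e ∈ Eg K V, ∀ c ∈ C, (e : Module.End K V) * c * ((e⁻¹ : (Module.End K V)ˣ) : Module.End K V) ∈ C)
    (c : Module.End K V) (hc : c ∈ C) (hsc : ¬ IsSc F c) : C = ⊤ := by
  obtain ⟨a, ha, ha2⟩ := exists_a F K
  obtain ⟨f, u, hu, hu'⟩ := exists_shift c (isInt S c)
  have huC : u ∈ UC C.toSubring := by
    refine ⟨?_, ?_⟩
    · rw [hu]; exact C.sub_mem hc (C.algebraMap_mem f)
    · have : Algebra.adjoin F {c} ≤ C := by rw [Algebra.adjoin_le_iff]; simpa using hc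
      exact this hu'
  obtain ⟨v, hv⟩ := exists_of_not_sc S c hsc
  have h1 : Eg K V ≤ UC C.toSubring := by
    refine eg_T1 S.h2 ha ha2 _ ?_ u huC v ?_
    · rintro e he h ⟨hh1, hh2⟩
      refine ⟨hC e he _ hh1, ?_⟩
      have := hC e he _ hh2
      simpa [mul_assoc] using this
    · rw [hu]
      intro h
      apply hv
      have h3 : (f • v : V) ∈ Submodule.span K {v} :=
        Submodule.smul_of_tower_mem _ f (Submodule.mem_span_singleton_self v)
      have := add_mem h h3
      simpa using this
  have h2 := subring_top_of_eg S.h2 C.toSubring (fun e he => (h1 he).1)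
  rw [eq_top_iff]
  intro x _
  have : x ∈ C.toSubring := h2 ▸ Subring.mem_top x
  exact this

/-- normalizer in G of a subset -/
def NG (G : Subgroup (Module.End K V)ˣ) (C : Set (Module.End K V)) : Subgroup (Module.End K V)ˣ where
  carrier := {g | g ∈ G ∧ (∀ c ∈ C, (g : Module.End K V) * c * ((g⁻¹ : (Module.End K V)ˣ) : Module.End K V) ∈ C) ∧
    ∀ c ∈ C, ((g⁻¹ : (Module.End K V)ˣ) : Module.End K V) * c * (g : Module.End K V) ∈ C}
  one_mem' := by simp [G.one_mem]
  mul_mem' := by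
    rintro a b ⟨h1, h2, h3⟩ ⟨k1, k2, k3⟩
    refine ⟨G.mul_mem h1 k1, fun c hc => ?_, fun c hc => ?_⟩
    · have := h2 _ (k2 c hc)
      simpa [mul_assoc] using this
    · have := k3 _ (h3 c hc)
      simpa [mul_assoc] using this
  inv_mem' := by
    rintro a ⟨h1, h2, h3⟩
    exact ⟨inv_mem h1, by simpa using h3, by simpa using h2⟩

/-- M-invariance -/
def InvM (M : Subgroup (Module.End K V)ˣ) (C : Set (Module.End K V)) : Prop :=
  ∀ m ∈ M, ∀ c ∈ C, (m : Module.End K V) * c * ((m⁻¹ : (Module.End K V)ˣ) : Module.End K V) ∈ C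

lemma inv' {C : Set (Module.End K V)} (h : InvM M C) : ∀ m ∈ M, ∀ c ∈ C,
    ((m⁻¹ : (Module.End K V)ˣ) : Module.End K V) * c * (m : Module.End K V) ∈ C := by
  intro m hm c hc
  have := h m⁻¹ (inv_mem hm) c hc
  simpa using this

lemma NG_cases (S : Setup F K V G M) {C : Set (Module.End K V)} (h : InvM M C) :
    NG G C = M ∨ NG G C = G :=
  S.hmax _ (fun m hm => ⟨S.hMG hm, h m hm, inv' h m hm⟩) (fun g hg => hg.1)

lemma star (S : Setup F K V G M) (C : Subalgebra F (Module.End K V)) (hC : InvM M (C : Set (Module.End K V))) :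
    C = ⊤ ∨ ∀ x ∈ C, ∀ y ∈ C, x * y = y * x := by
  classical
  rcases NG_cases S hC with h | h
  · right
    have hUC : UC C.toSubring ⊓ G ≤ M := by
      rintro u ⟨⟨h1, h2⟩, h3⟩
      rw [← h]
      exact ⟨h3, fun c hc => C.mul_mem (C.mul_mem h1 hc) h2, fun c hc => C.mul_mem (C.mul_mem h2 hc) h1⟩
    let f : C × C × C → Submodule K V := fun t => LinearMap.ker
      (((t.1 : Module.End K V) * (t.2.1 : Module.End K V) - (t.2.1 : Module.End K V) * (t.1 : Module.End K V)) * (t.2.2 : Module.End K V))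
    let W := ⨅ t, f t
    have hWm : ∀ v, v ∈ W ↔ ∀ t, (((t : C × C × C).1 : Module.End K V) * (t.2.1 : Module.End K V) - (t.2.1 : Module.End K V) * (t.1 : Module.End K V)) ((t.2.2 : Module.End K V) v) = 0 := by
      intro v
      simp only [W, Submodule.mem_iInf, f, LinearMap.mem_ker, Module.End.mul_apply]
    have hW : W = ⊥ ∨ W = ⊤ := by
      apply irred S
      intro m hm w hw
      rw [hWm] at hw ⊢
      rintro ⟨⟨x, hx⟩, ⟨y, hy⟩, ⟨z, hz⟩⟩
      have := hw ⟨⟨_, inv' hC m hm x hx⟩, ⟨_, inv' hC m hm y hy⟩, ⟨_, inv' hC m hm z hz⟩⟩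
      have h4 := congrArg (m : Module.End K V) this
      simpa [un_inv_r] using h4
    have hne : W ≠ ⊥ := by
      intro hb
      obtain ⟨s, hs⟩ := Finset.exists_inf_le f
      let T : Finset (Module.End K V) := s.biUnion fun t => {(t.1 : Module.End K V), (t.2.1 : Module.End K V), (t.2.2 : Module.End K V)}
      have hfin := S.hlf T
      have hTC : Algebra.adjoin F (T : Set (Module.End K V)) ≤ C := by
        rw [Algebra.adjoin_le_iff]
        intro x hx
        simp only [T, Finset.coe_biUnion, Set.mem_iUnion] at hx
        obtain ⟨t, ht, hx⟩ := hx
        simp at hx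
        rcases hx with rfl | rfl | rfl
        exacts [t.1.2, t.2.1.2, t.2.2.2]
      obtain ⟨v, hv0, hv⟩ := exists_killed S C.toSubring hUC (Algebra.adjoin F (T : Set (Module.End K V))) (fun x hx => hTC hx)
      apply hv0
      have hvs : v ∈ s.inf f := by
        rw [Submodule.mem_finsetInf]
        intro t ht
        have hsub : ∀ x ∈ ({(t.1 : Module.End K V), (t.2.1 : Module.End K V), (t.2.2 : Module.End K V)} : Finset _), x ∈ Algebra.adjoin F (T : Set (Module.End K V)) :=
          fun x hx => Algebra.subset_adjoin (Finset.mem_coe.2 (Finset.mem_biUnion.2 ⟨t, ht, hx⟩))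
        exact hv _ (hsub _ (by simp)) _ (hsub _ (by simp)) _ (hsub _ (by simp))
      have : v ∈ W := by
        rw [Submodule.mem_iInf]
        intro t
        exact hs t hvs
      rw [hb] at this
      simpa using this
    have ht := hW.resolve_left hne
    intro x hx y hy
    rw [← sub_eq_zero]
    ext v
    have := (hWm v).1 (ht ▸ Submodule.mem_top) ⟨⟨x, hx⟩, ⟨y, hy⟩, 1⟩
    simpa using this
  · by_cases hsc : ∃ c ∈ C, ¬ IsSc F c
    · left
      obtain ⟨c, hc, hsc⟩ := hsc
      exact top_of_normalized S C (fun e he c hc => (h.ge (S.hEG he)).2.1 c hc) c hc hsc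
    · right
      push Not at hsc
      intro x hx y hy
      obtain ⟨f, rfl⟩ := hsc x hx
      exact Algebra.commutes f y

end PartFive

section GLs
variable {F L : Type*} [Field F] [Field L] [Algebra F L]

theorem gl_finite [Algebra.IsAlgebraic F L] (H : Subgroup (L ≃ₐ[F] L)) (hne : H ≠ ⊥)
    (hfix : ∀ N : Subgroup (L ≃ₐ[F] L), N ≤ H → (∀ h ∈ H, ∀ n ∈ N, h * n * h⁻¹ ∈ N) → N ≠ ⊥ →
      ∀ x : L, (∀ σ ∈ N, σ x = x) → ∃ f, algebraMap F L f = x) : Finite H := by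
  obtain ⟨σ0, hσ0, hσ1⟩ := Subgroup.ne_bot_iff_exists_ne_one.1 hne |>.elim
    (fun a ha => (⟨a.1, a.2, fun h => ha (Subtype.ext h)⟩ : ∃ σ0, σ0 ∈ H ∧ σ0 ≠ 1))
  obtain ⟨x0, hx0⟩ : ∃ x0, σ0 x0 ≠ x0 := by
    by_contra h
    push Not at h
    exact hσ1 (AlgEquiv.ext h)
  let N0 : Subgroup (L ≃ₐ[F] L) :=
    { carrier := {σ | σ ∈ H ∧ ∀ τ ∈ H, σ (τ x0) = τ x0}
      one_mem' := ⟨H.one_mem, fun τ _ => rfl⟩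
      mul_mem' := by
        rintro a b ⟨ha, ha'⟩ ⟨hb, hb'⟩
        refine ⟨H.mul_mem ha hb, fun τ hτ => ?_⟩
        rw [AlgEquiv.mul_apply, hb' τ hτ, ha' τ hτ]
      inv_mem' := by
        rintro a ⟨ha, ha'⟩
        refine ⟨H.inv_mem ha, fun τ hτ => ?_⟩
        have := ha' τ hτ
        conv_lhs => rw [← this]
        rw [← AlgEquiv.mul_apply, inv_mul_cancel, AlgEquiv.one_apply] }
  have hN0 : N0 = ⊥ := by
    by_contra hN
    obtain ⟨f, hf⟩ := hfix N0 (fun σ h => h.1) (by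
      rintro h hh n ⟨hn, hn'⟩
      refine ⟨H.mul_mem (H.mul_mem hh hn) (H.inv_mem hh), fun τ hτ => ?_⟩
      have := hn' (h⁻¹ * τ) (H.mul_mem (H.inv_mem hh) hτ)
      rw [AlgEquiv.mul_apply] at this
      rw [AlgEquiv.mul_apply, AlgEquiv.mul_apply, this, ← AlgEquiv.mul_apply, mul_inv_cancel,
        AlgEquiv.one_apply]) hN x0 (fun σ hσ => hσ.2 1 H.one_mem)
    exact hx0 (by rw [← hf, AlgEquiv.commutes])
  let R := (minpoly F x0).rootSet L
  have hR : ∀ σ : L ≃ₐ[F] L, σ x0 ∈ R := by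
    intro σ
    refine Polynomial.mem_rootSet.2 ⟨minpoly.ne_zero (Algebra.IsIntegral.isIntegral x0), ?_⟩
    have h0 := Polynomial.aeval_algHom_apply (σ : L →ₐ[F] L) x0 (minpoly F x0)
    rw [minpoly.aeval, map_zero] at h0
    exact h0
  have hRf : ∀ σ : L ≃ₐ[F] L, ∀ r ∈ R, σ r ∈ R := by
    intro σ r hr
    have := Polynomial.mem_rootSet.1 hr
    refine Polynomial.mem_rootSet.2 ⟨this.1, ?_⟩
    have h0 := Polynomial.aeval_algHom_apply (σ : L →ₐ[F] L) r (minpoly F x0)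
    rw [this.2, map_zero] at h0
    exact h0
  haveI : Finite R := (Polynomial.rootSet_finite _ _).to_subtype
  refine Finite.of_injective (fun (σ : H) (r : R) => (⟨σ.1 r.1, hRf σ.1 r.1 r.2⟩ : R)) ?_
  rintro ⟨a, ha⟩ ⟨b, hb⟩ hab
  have hab' : ∀ r ∈ R, a r = b r := fun r hr =>
    congrArg Subtype.val (congrFun hab ⟨r, hr⟩)
  have : b⁻¹ * a ∈ N0 := by
    refine ⟨H.mul_mem (H.inv_mem hb) ha, fun τ hτ => ?_⟩
    rw [AlgEquiv.mul_apply, hab' _ (hR τ), ← AlgEquiv.mul_apply, inv_mul_cancel,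
        AlgEquiv.one_apply]
  rw [hN0, Subgroup.mem_bot, inv_mul_eq_one] at this
  exact Subtype.ext this.symm

theorem gl_card (N : Subgroup (L ≃ₐ[F] L)) [Finite N]
    (h : ∀ x : L, (∀ σ ∈ N, σ x = x) → ∃ f, algebraMap F L f = x) :
    Module.finrank F L = Nat.card N := by
  haveI := Fintype.ofFinite N
  rw [Nat.card_eq_fintype_card, ← FixedPoints.finrank_eq_card N L]
  let g : F →+* FixedPoints.subfield N L :=
    (algebraMap F L).codRestrict (FixedPoints.subfield N L) (fun f σ => by
      change σ.1 (algebraMap F L f) = _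
      exact AlgEquiv.commutes _ _)
  have hg : Function.Bijective g := by
    refine ⟨g.injective, ?_⟩
    rintro ⟨x, hx⟩
    obtain ⟨f, hf⟩ := h x (fun σ hσ => hx ⟨σ, hσ⟩)
    exact ⟨f, Subtype.ext hf⟩
  exact Algebra.finrank_eq_of_equiv_equiv (RingEquiv.ofBijective g hg) (RingEquiv.refl L) rfl

theorem gl_prime [Algebra.IsAlgebraic F L] (H : Subgroup (L ≃ₐ[F] L)) (hne : H ≠ ⊥)
    (hs : Group.IsSolvable H)
    (hfix : ∀ N : Subgroup (L ≃ₐ[F] L), N ≤ H → (∀ h ∈ H, ∀ n ∈ N, h * n * h⁻¹ ∈ N) → N ≠ ⊥ →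
      ∀ x : L, (∀ σ ∈ N, σ x = x) → ∃ f, algebraMap F L f = x) :
    Finite H ∧ (Nat.card H).Prime ∧ Module.finrank F L = Nat.card H := by
  haveI := gl_finite H hne hfix
  have hc := gl_card H (hfix H le_rfl (fun h hh n hn => H.mul_mem (H.mul_mem hh hn)
    (H.inv_mem hh)) hne)
  refine ⟨inferInstance, ?_, hc⟩
  haveI : IsSimpleGroup H := by
    rw [Subgroup.isSimpleGroup_iff]
    refine ⟨hne, fun N hN hn => ?_⟩
    by_cases hb : N = ⊥
    · exact Or.inl hb
    right
    haveI : Finite N := Finite.of_injective (Subgroup.inclusion hN) (Subgroup.inclusion_injective hN)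
    have hcN := gl_card N (hfix N hN (by
      intro h hh n hn'
      exact Subgroup.mem_subgroupOf.1 (hn.conj_mem ⟨n, hN hn'⟩ (Subgroup.mem_subgroupOf.2 hn') ⟨h, hh⟩)) hb)
    exact Subgroup.eq_of_le_of_card_ge hN (by rw [← hcN, hc])
  have hcomm := IsSimpleGroup.comm_iff_isSolvable.2 hs
  letI : CommGroup H := { (inferInstance : Group H) with mul_comm := hcomm }
  exact IsSimpleGroup.prime_card (α := H)

end GLs

section crossed
variable {F L A : Type*} [Field F] [Field L] [Algebra F L] [Ring A] [Nontrivial A] [Algebra F A]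

theorem crossed_hom (ι : L →ₐ[F] A) (M : Subgroup Aˣ)
    (hM : ∀ m ∈ M, ∀ x, ∃ y, (m : A) * ι x * (m⁻¹ : Aˣ) = ι y) :
    ∃ φ : M →* (L ≃ₐ[F] L), ∀ (m : M) x, ι (φ m x) * ((m : Aˣ) : A) = ((m : Aˣ) : A) * ι x := by
  have hinj : Function.Injective ι := ι.toRingHom.injective
  choose f hf using fun m : M => hM m.1 m.2
  have spec : ∀ (m : M) x, ι (f m x) * ((m : Aˣ) : A) = ((m : Aˣ) : A) * ι x := by
    intro m x
    rw [← hf, mul_assoc, Units.inv_mul, mul_one]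
  have uniq : ∀ (m : M) x y, ι y * ((m : Aˣ) : A) = ((m : Aˣ) : A) * ι x → f m x = y := by
    intro m x y h
    apply hinj
    rw [← spec] at h
    exact ((Units.mul_left_inj _).1 h).symm
  have fmul : ∀ (m n : M) x, f (m * n) x = f m (f n x) := by
    intro m n x
    apply uniq
    rw [Subgroup.coe_mul, Units.val_mul, ← mul_assoc, spec, mul_assoc, spec, mul_assoc]
  have fone : ∀ x, f 1 x = x := by
    intro x
    apply uniq
    simp
  let e : M → (L ≃ₐ[F] L) := fun m =>
    { toFun := f m
      invFun := f m⁻¹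
      left_inv := fun x => by rw [← fmul, inv_mul_cancel, fone]
      right_inv := fun x => by rw [← fmul, mul_inv_cancel, fone]
      map_mul' := fun x y => by
        apply uniq
        rw [map_mul, mul_assoc, spec, ← mul_assoc, spec, map_mul, mul_assoc]
      map_add' := fun x y => by
        apply uniq
        rw [map_add, add_mul, spec, spec, map_add, mul_add]
      commutes' := fun x => by
        apply uniq
        rw [AlgHom.commutes, Algebra.commutes] }
  exact ⟨{ toFun := e
           map_one' := AlgEquiv.ext fone
           map_mul' := fun m n => AlgEquiv.ext (fmul m n) }, spec⟩

theorem crossed_dim (ι : L →ₐ[F] A) (M : Subgroup Aˣ) [Algebra.IsAlgebraic F L]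
    (hsol : Group.IsSolvable M)
    (hM : ∀ m ∈ M, ∀ x, ∃ y, (m : A) * ι x * (m⁻¹ : Aˣ) = ι y)
    (hself : ∀ a : A, (∀ x, a * ι x = ι x * a) → ∃ x, ι x = a)
    (hgen : Algebra.adjoin F (Set.range ι ∪ {a | ∃ m ∈ M, (m : A) = a}) = ⊤)
    (hmove : ∃ m ∈ M, ∃ x, (m : A) * ι x ≠ ι x * m)
    (hfix : ∀ N : Subgroup Aˣ, N ≤ M → (∀ m ∈ M, ∀ n ∈ N, m * n * m⁻¹ ∈ N) →
      (∃ n ∈ N, ∃ x, (n : A) * ι x ≠ ι x * n) → ∀ x, (∀ n ∈ N, (n : A) * ι x = ι x * n) →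
      ∃ f, algebraMap F L f = x) :
    ∃ p, Nat.Prime p ∧ Module.finrank F A = p * p := by
  have hinj : Function.Injective ι := ι.toRingHom.injective
  obtain ⟨φ, spec⟩ := crossed_hom ι M hM
  have hfx : ∀ (m : M) x, φ m x = x ↔ ((m : Aˣ) : A) * ι x = ι x * ((m : Aˣ) : A) := by
    intro m x
    rw [← spec, Units.mul_left_inj]
    exact hinj.eq_iff.symm
  have hH := gl_prime φ.range (by
      obtain ⟨m, hm, x, hx⟩ := hmove
      intro hb
      have : φ ⟨m, hm⟩ = 1 := by
        rw [← Subgroup.mem_bot, ← hb]; exact ⟨_, rfl⟩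
      exact hx ((hfx ⟨m, hm⟩ x).1 (by rw [this]; rfl)))
    (solvable_of_surjective φ.rangeRestrict_surjective) (by
      intro N hN hnorm hne x hx
      refine hfix ((N.comap φ).map M.subtype) ?_ ?_ ?_ x ?_
      · rintro _ ⟨m, -, rfl⟩
        exact m.2
      · rintro m hm _ ⟨n, hn, rfl⟩
        refine ⟨⟨m, hm⟩ * n * ⟨m, hm⟩⁻¹, ?_, rfl⟩
        change φ _ ∈ N
        rw [map_mul, map_mul, map_inv]
        exact hnorm _ ⟨_, rfl⟩ _ hn
      · obtain ⟨⟨σ, hσ⟩, hσ1⟩ := Subgroup.ne_bot_iff_exists_ne_one.1 hne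
        obtain ⟨n, rfl⟩ := hN hσ
        by_contra hcon
        push Not at hcon
        apply hσ1
        apply Subtype.ext
        apply AlgEquiv.ext
        intro y
        exact (hfx n y).2 (hcon n.1 ⟨n, hσ, rfl⟩ y)
      · rintro _ ⟨n, hn, rfl⟩
        exact (hfx n x).1 (hx _ hn))
  obtain ⟨hfin, hp, hcard⟩ := hH
  refine ⟨_, hp, ?_⟩
  haveI := Fintype.ofFinite φ.range
  haveI : Module.Finite F L := Module.finite_of_finrank_pos (by rw [hcard]; exact hp.pos)
  choose u hu using fun σ : φ.range => σ.2
  let Φ : (φ.range → L) →ₗ[F] A :=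
    { toFun := fun c => ∑ σ, ι (c σ) * ((u σ : Aˣ) : A)
      map_add' := fun c d => by
        rw [← Finset.sum_add_distrib]
        exact Finset.sum_congr rfl fun σ _ => by rw [Pi.add_apply, map_add, add_mul]
      map_smul' := fun r c => by
        rw [RingHom.id_apply, Finset.smul_sum]
        exact Finset.sum_congr rfl fun σ _ => by rw [Pi.smul_apply, map_smul, smul_mul_assoc] }
  have hΦinj : ∀ (s : Finset φ.range) (c : φ.range → L),
      ∑ σ ∈ s, ι (c σ) * ((u σ : Aˣ) : A) = 0 → ∀ σ ∈ s, c σ = 0 := by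
    classical
    intro s
    induction s using Finset.induction_on with
    | empty => simp
    | insert τ s hτ ih =>
      intro c hc
      have key : ∀ x, ∀ σ ∈ s, c σ * (σ.1 x - τ.1 x) = 0 := by
        intro x
        apply ih
        have h1 : (∑ σ ∈ insert τ s, ι (c σ) * ((u σ : Aˣ) : A)) * ι x
            - ι (τ.1 x) * (∑ σ ∈ insert τ s, ι (c σ) * ((u σ : Aˣ) : A)) = 0 := by
          rw [hc]; simp
        rw [Finset.sum_mul, Finset.mul_sum, ← Finset.sum_sub_distrib] at h1
        have h2 : ∀ σ : φ.range, ι (c σ) * ((u σ : Aˣ) : A) * ι x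
            - ι (τ.1 x) * (ι (c σ) * ((u σ : Aˣ) : A))
            = ι (c σ * (σ.1 x - τ.1 x)) * ((u σ : Aˣ) : A) := by
          intro σ
          rw [mul_assoc, ← spec, hu, ← mul_assoc, ← mul_assoc, ← map_mul, ← map_mul, ← sub_mul,
            ← map_sub]
          congr 2
          ring
        rw [Finset.sum_congr rfl (fun σ _ => h2 σ), Finset.sum_insert hτ, sub_self, mul_zero,
          map_zero, zero_mul, zero_add] at h1
        exact h1
      have h0 : ∀ σ ∈ s, c σ = 0 := by
        intro σ hσ
        have hne : σ ≠ τ := fun h => hτ (h ▸ hσ)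
        by_contra hcσ
        apply hne
        apply Subtype.ext
        apply AlgEquiv.ext
        intro x
        exact sub_eq_zero.1 ((mul_eq_zero.1 (key x σ hσ)).resolve_left hcσ)
      rw [Finset.sum_insert hτ, Finset.sum_eq_zero (fun σ hσ => by rw [h0 σ hσ, map_zero, zero_mul]),
        add_zero] at hc
      have : c τ = 0 := by
        apply hinj
        rw [map_zero]
        exact (Units.mul_left_eq_zero _).1 hc
      intro σ hσ
      rcases Finset.mem_insert.1 hσ with rfl | h
      · exact this
      · exact h0 σ h
  have hΦi : Function.Injective Φ := by
    rw [← LinearMap.ker_eq_bot, LinearMap.ker_eq_bot']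
    intro c hc
    funext σ
    exact hΦinj Finset.univ c hc σ (Finset.mem_univ _)
  have hmem : ∀ (x : L) (m : M), ι x * ((m : Aˣ) : A) ∈ LinearMap.range Φ := by
    classical
    intro x m
    let σ : φ.range := ⟨φ m, m, rfl⟩
    obtain ⟨y, hy⟩ := hself (((m * (u σ)⁻¹ : M) : Aˣ) : A) (by
      intro x
      rw [← hfx, map_mul, map_inv, hu, mul_inv_cancel]
      rfl)
    refine ⟨Pi.single σ (x * y), ?_⟩
    change ∑ τ, _ = _
    rw [Finset.sum_eq_single σ]
    · rw [Pi.single_eq_same, map_mul, hy, mul_assoc, ← Units.val_mul, ← Subgroup.coe_mul,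
        inv_mul_cancel_right]
    · intro τ _ hτ
      rw [Pi.single_eq_of_ne hτ, map_zero, zero_mul]
    · simp
  have hΦs : LinearMap.range Φ = ⊤ := by
    rw [eq_top_iff]
    let P : Submonoid A :=
      { carrier := {a | ∃ (x : L) (m : M), ι x * ((m : Aˣ) : A) = a}
        one_mem' := ⟨1, 1, by simp⟩
        mul_mem' := by
          rintro _ _ ⟨x, m, rfl⟩ ⟨y, n, rfl⟩
          refine ⟨x * φ m y, m * n, ?_⟩
          rw [map_mul, Subgroup.coe_mul, Units.val_mul, mul_assoc, ← mul_assoc (ι (φ m y)), spec,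
            mul_assoc, mul_assoc] }
    have h1 : (⊤ : Submodule F A) = Submodule.span F (Submonoid.closure
        (Set.range ι ∪ {a | ∃ m ∈ M, (m : A) = a}) : Set A) := by
      rw [← Algebra.adjoin_eq_span, hgen, Algebra.top_toSubmodule]
    rw [h1, Submodule.span_le]
    have h2 : Submonoid.closure (Set.range ι ∪ {a | ∃ m ∈ M, (m : A) = a}) ≤ P := by
      rw [Submonoid.closure_le]
      rintro _ (⟨x, rfl⟩ | ⟨m, hm, rfl⟩)
      · exact ⟨x, 1, by simp⟩
      · exact ⟨1, ⟨m, hm⟩, by simp⟩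
    intro a ha
    obtain ⟨x, m, rfl⟩ := h2 ha
    exact hmem x m
  have e := LinearEquiv.ofBijective Φ ⟨hΦi, LinearMap.range_eq_top.1 hΦs⟩
  rw [← e.finrank_eq, Module.finrank_pi_fintype, Finset.sum_const, hcard, Finset.card_univ,
    Nat.card_eq_fintype_card, smul_eq_mul]

end crossed

section fitting
variable {F A : Type*} [Field F] [CommRing A] [Algebra F A]

lemma fit (c : A) (hc : IsIntegral F c) :
    ∃ (k : ℕ) (e : A), e * e = e ∧ c ^ (k + 1) * e = c ^ (k + 1) ∧ c ∣ e := by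
  obtain ⟨q, hq, hnd⟩ := Polynomial.exists_eq_pow_rootMultiplicity_mul_and_not_dvd
    (minpoly F c) (minpoly.ne_zero hc) 0
  set k := Polynomial.rootMultiplicity 0 (minpoly F c)
  rw [Polynomial.C_0, sub_zero] at hq hnd
  have hq0 : q.coeff 0 ≠ 0 := fun h => hnd (Polynomial.X_dvd_iff.2 h)
  have h1 : c ^ k * (Polynomial.aeval c q.divX * c + algebraMap F A (q.coeff 0)) = 0 := by
    have := minpoly.aeval F c
    rw [hq, ← Polynomial.divX_mul_X_add q] at this
    simpa using this
  set d := Polynomial.aeval c q.divX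
  set i := algebraMap F A (q.coeff 0)⁻¹
  have hi : algebraMap F A (q.coeff 0) * i = 1 := by
    rw [← map_mul, mul_inv_cancel₀ hq0, map_one]
  let g := - (i * d)
  have h2 : c ^ (k + 1) * (c * g) = c ^ (k + 1) := by
    have : c ^ (k + 1) * (c * g) - c ^ (k + 1) =
        - (c ^ k * (d * c + algebraMap F A (q.coeff 0))) * c * i
         + c ^ (k + 1) * (algebraMap F A (q.coeff 0) * i - 1) := by
      simp only [g]; ring
    rw [h1, hi] at this
    simpa [sub_eq_zero] using this
  have h3 : ∀ j, c ^ (k + 1) * (c * g) ^ j = c ^ (k + 1) := by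
    intro j
    induction j with
    | zero => simp
    | succ j ih => rw [pow_succ (c * g), ← mul_assoc, ih, h2]
  refine ⟨k, (c * g) ^ (k + 1), ?_, h3 _, ?_⟩
  · conv_lhs => rw [mul_pow c g, mul_right_comm, ← mul_pow c g, h3]
    rw [mul_pow]
  · exact (Dvd.intro g rfl).trans (dvd_pow_self _ (Nat.succ_ne_zero k))
end fitting

section PartSeven
variable {F K V : Type*} [Field F] [Infinite F] [DivisionRing K] [Algebra F K] [AddCommGroup V]
  [Module K V] [Module F V] [IsScalarTower F K V] [Module.Finite K V]
  {G M : Subgroup (Module.End K V)ˣ}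

lemma range_mul' (x y : Module.End K V) :
    LinearMap.range (x * y) = (LinearMap.range y).map x := LinearMap.range_comp y x

lemma isSc_of_central (S : Setup F K V G M) (c : Module.End K V) (h : ∀ x, c * x = x * c) :
    IsSc F c := by
  apply isSc_of_span S
  intro v
  by_contra hv
  obtain ⟨φ, h1, h2⟩ := dual_pair hv
  have := congrArg (fun y : Module.End K V => y v) (h (φ.smulRight (c v)))
  simp only [Module.End.mul_apply, LinearMap.smulRight_apply,
    h2 v (Submodule.mem_span_singleton_self v), h1] at this
  simp only [zero_smul, map_zero, one_smul] at this
  exact hv (by rw [← this]; exact zero_mem _)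

lemma inv_centralizer {E : Set (Module.End K V)} (hE : InvM M E) :
    InvM M (Subalgebra.centralizer F E : Set (Module.End K V)) := by
  intro m hm x hx
  rw [SetLike.mem_coe, Subalgebra.mem_centralizer_iff] at hx ⊢
  intro e he
  have h1 := hx _ (inv' hE m hm e he)
  have h2 : (m : Module.End K V) * (((m⁻¹ : (Module.End K V)ˣ) : Module.End K V) * e * m * x) * ((m⁻¹ : (Module.End K V)ˣ) : Module.End K V)
    = (m : Module.End K V) * (x * (((m⁻¹ : (Module.End K V)ˣ) : Module.End K V) * e * m)) * ((m⁻¹ : (Module.End K V)ˣ) : Module.End K V) := by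
    rw [h1]
  simpa [mul_assoc] using h2

lemma inv_adjoin {E : Set (Module.End K V)} (hE : InvM M E) :
    InvM M (Algebra.adjoin F E : Set (Module.End K V)) := by
  intro m hm x hx
  induction hx using Algebra.adjoin_induction with
  | mem x hx => exact Algebra.subset_adjoin (hE m hm x hx)
  | algebraMap r =>
    rw [← Algebra.commutes, mul_assoc, Units.mul_inv, mul_one]
    exact Subalgebra.algebraMap_mem _ r
  | add x y _ _ h1 h2 =>
    rw [mul_add, add_mul]
    exact Subalgebra.add_mem _ h1 h2
  | mul x y _ _ h1 h2 =>
    have := Subalgebra.mul_mem _ h1 h2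
    simpa [mul_assoc] using this

lemma cent_comm (S : Setup F K V G M) {E : Set (Module.End K V)} (hE : InvM M E)
    {c : Module.End K V} (hc : c ∈ E) (hsc : ¬ IsSc F c) :
    ∀ x ∈ Subalgebra.centralizer F E, ∀ y ∈ Subalgebra.centralizer F E, x * y = y * x := by
  rcases star S (Subalgebra.centralizer F E) (inv_centralizer hE) with h | h
  · exfalso
    apply hsc
    apply isSc_of_central S
    intro x
    have : x ∈ Subalgebra.centralizer F E := by rw [h]; trivial
    exact (Subalgebra.mem_centralizer_iff F).1 this c hc
  · exact h

lemma units_of_C (S : Setup F K V G M) (C : Subalgebra F (Module.End K V))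
    (hinv : InvM M (C : Set (Module.End K V))) (hcomm : ∀ x ∈ C, ∀ y ∈ C, x * y = y * x) :
    ∀ x ∈ C, x ≠ 0 → IsUnit x := by
  classical
  have hex : ∃ n, ∃ c ∈ C, c ≠ 0 ∧ Module.finrank K (LinearMap.range c) = n := by
    refine ⟨_, 1, C.one_mem, ?_, rfl⟩
    obtain ⟨u, hu⟩ := exists_ne_zero_v S.h2
    intro h
    exact hu (by simpa using congrArg (fun y : Module.End K V => y u) h)
  have hmin' : ∀ d ∈ C, d ≠ 0 → Nat.find hex ≤ Module.finrank K (LinearMap.range d) :=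
    fun d hd hd0 => Nat.find_min' hex ⟨d, hd, hd0, rfl⟩
  obtain ⟨c, hc, hc0, hcr⟩ := Nat.find_spec hex
  rw [← hcr] at hmin'
  set r := Module.finrank K (LinearMap.range c)
  -- range of a product
  have rng : ∀ x ∈ C, Module.finrank K (LinearMap.range x) ≤ r → ∀ y ∈ C, x * y ≠ 0 →
      LinearMap.range (x * y) = LinearMap.range x := by
    intro x hx hxr y hy hxy
    apply Submodule.eq_of_le_of_finrank_le
    · rintro _ ⟨v, rfl⟩
      exact ⟨y v, rfl⟩
    · exact hxr.trans (hmin' _ (C.mul_mem hx hy) hxy)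
  have rng2 : ∀ x ∈ C, Module.finrank K (LinearMap.range x) ≤ r → ∀ y ∈ C,
      Module.finrank K (LinearMap.range y) ≤ r → x * y ≠ 0 →
      LinearMap.range x = LinearMap.range y := by
    intro x hx hxr y hy hyr hxy
    rw [← rng x hx hxr y hy hxy, hcomm x hx y hy, rng y hy hyr x hx (by rwa [hcomm y hy x hx])]
  have conjr : ∀ x : Module.End K V, Module.finrank K (LinearMap.range x) ≤ r → ∀ m : (Module.End K V)ˣ,
      Module.finrank K (LinearMap.range ((m : Module.End K V) * x * ((m⁻¹ : (Module.End K V)ˣ) : Module.End K V))) ≤ r := by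
    intro x hx m
    refine le_trans ?_ ((Submodule.finrank_map_le (m : Module.End K V) (LinearMap.range x)).trans hx)
    apply Submodule.finrank_mono
    rintro _ ⟨v, rfl⟩
    exact ⟨_, ⟨_, rfl⟩, rfl⟩
  -- c is not square-zero
  have hcc : c * c ≠ 0 := by
    intro hcc
    have hz : ∀ m ∈ M, ((m : Module.End K V) * c * ((m⁻¹ : (Module.End K V)ˣ) : Module.End K V)) * c = 0 := by
      intro m hm
      by_contra hne
      have h1 := hinv m hm c hc
      have h2 := rng2 _ h1 (conjr c le_rfl m) c hc le_rfl hne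
      have h3 := rng _ h1 (conjr c le_rfl m) c hc hne
      have h4 : LinearMap.range (((m : Module.End K V) * c * ((m⁻¹ : (Module.End K V)ˣ) : Module.End K V)) *
          ((m : Module.End K V) * c * ((m⁻¹ : (Module.End K V)ˣ) : Module.End K V))) =
          LinearMap.range (((m : Module.End K V) * c * ((m⁻¹ : (Module.End K V)ˣ) : Module.End K V)) * c) := by
        rw [range_mul', range_mul' _ c, h2]
      have h5 : ((m : Module.End K V) * c * ((m⁻¹ : (Module.End K V)ˣ) : Module.End K V)) *
          ((m : Module.End K V) * c * ((m⁻¹ : (Module.End K V)ˣ) : Module.End K V)) = 0 := by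
        have : ((m : Module.End K V) * c * ((m⁻¹ : (Module.End K V)ˣ) : Module.End K V)) *
          ((m : Module.End K V) * c * ((m⁻¹ : (Module.End K V)ˣ) : Module.End K V)) =
          (m : Module.End K V) * (c * c) * ((m⁻¹ : (Module.End K V)ˣ) : Module.End K V) := by
          simp [mul_assoc]
        rw [this, hcc]; simp
      rw [h5, LinearMap.range_zero] at h4
      exact hne (LinearMap.range_eq_bot.1 h4.symm)
    let W : Submodule K V :=
      ⨅ m : M, LinearMap.ker (((m : (Module.End K V)ˣ) : Module.End K V) * c * (((m : (Module.End K V)ˣ)⁻¹ : (Module.End K V)ˣ) : Module.End K V))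
    have hWm : ∀ v, v ∈ W ↔ ∀ m ∈ M, ((m : Module.End K V) * c * ((m⁻¹ : (Module.End K V)ˣ) : Module.End K V)) v = 0 := by
      intro v
      simp only [W, Submodule.mem_iInf, LinearMap.mem_ker, Subtype.forall]
    rcases irred S W (by
      intro m hm w hw
      rw [hWm] at hw ⊢
      intro n hn
      have := hw (m⁻¹ * n) (M.mul_mem (M.inv_mem hm) hn)
      have h6 := congrArg (fun y => (m : Module.End K V) y) this
      simp only [map_zero] at h6
      rw [← h6, ← Module.End.mul_apply, ← Module.End.mul_apply]
      congr 1
      simp [mul_assoc]) with h | h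
    · apply hc0
      ext v
      have : c v ∈ W := by
        rw [hWm]
        intro m hm
        exact congrArg (fun y : Module.End K V => y v) (hz m hm)
      rw [h] at this
      simpa using this
    · apply hc0
      ext v
      have : v ∈ W := by rw [h]; trivial
      simpa using (hWm v).1 this 1 M.one_mem
  have hpow : ∀ k, c ^ (k + 1) ≠ 0 ∧ LinearMap.range (c ^ (k + 1)) = LinearMap.range c := by
    intro k
    have : LinearMap.range (c ^ (k + 1)) = LinearMap.range c := by
      induction k with
      | zero => simp
      | succ k ih =>
        rw [pow_succ', Module.End.mul_eq_comp, LinearMap.range_comp, ih, ← LinearMap.range_comp,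
          ← Module.End.mul_eq_comp]
        exact rng c hc le_rfl c hc hcc
    refine ⟨fun h => ?_, this⟩
    rw [h, LinearMap.range_zero] at this
    exact hc0 (LinearMap.range_eq_bot.1 this.symm)
  obtain ⟨e, he, hee, he0, her⟩ : ∃ e ∈ C, e * e = e ∧ e ≠ 0 ∧
      Module.finrank K (LinearMap.range e) ≤ r := by
    letI : CommRing C := { (inferInstance : Ring C) with
      mul_comm := fun x y => Subtype.ext (hcomm x.1 x.2 y.1 y.2) }
    have hIntegral : IsIntegral F (⟨c, hc⟩ : C) :=
      (isIntegral_algHom_iff C.val Subtype.val_injective).1 (isInt S c)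
    obtain ⟨k, e, h1, h2, ⟨d, h3⟩⟩ := fit (⟨c, hc⟩ : C) hIntegral
    refine ⟨e.1, e.2, congrArg Subtype.val h1, fun h => (hpow k).1 ?_, ?_⟩
    · have h2' : c ^ (k + 1) * e.1 = c ^ (k + 1) := congrArg Subtype.val h2
      rw [← h2', h, mul_zero]
    · have h3' : e.1 = c * d.1 := congrArg Subtype.val h3
      rw [h3']
      apply Submodule.finrank_mono
      rintro _ ⟨v, rfl⟩
      exact ⟨_, rfl⟩
  have hfixr : ∀ x : Module.End K V, x * x = x → ∀ v ∈ LinearMap.range x, x v = v := by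
    rintro x hx _ ⟨v, rfl⟩
    exact congrArg (fun y : Module.End K V => y v) hx
  -- conjugates of e
  have hconj : ∀ m ∈ M, e * ((m : Module.End K V) * e * ((m⁻¹ : (Module.End K V)ˣ) : Module.End K V)) = 0 ∨
      (m : Module.End K V) * e * ((m⁻¹ : (Module.End K V)ˣ) : Module.End K V) = e := by
    intro m hm
    by_cases hz : e * ((m : Module.End K V) * e * ((m⁻¹ : (Module.End K V)ˣ) : Module.End K V)) = 0
    · exact Or.inl hz
    right
    have h1 := hinv m hm e he
    have h2 := rng2 e he her _ h1 (conjr e her m) hz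
    set e' := (m : Module.End K V) * e * ((m⁻¹ : (Module.End K V)ˣ) : Module.End K V) with he'
    have hee' : e' * e' = e' := by
      have : e' * e' = (m : Module.End K V) * (e * e) * ((m⁻¹ : (Module.End K V)ˣ) : Module.End K V) := by
        simp [he', mul_assoc]
      rw [this, hee]
    have h3 : e * e' = e' := by
      ext v
      exact hfixr e hee _ (by rw [h2]; exact ⟨v, rfl⟩)
    have h4 : e' * e = e := by
      ext v
      exact hfixr e' hee' _ (by rw [← h2]; exact ⟨v, rfl⟩)
    rw [← h3, hcomm e he e' h1, h4]
  have hesc : IsSc F e := by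
    by_contra hsc
    let E : Set (Module.End K V) := {x | ∃ m ∈ M, x = (m : Module.End K V) * e * ((m⁻¹ : (Module.End K V)ˣ) : Module.End K V)}
    have hE : InvM M E := by
      rintro m hm _ ⟨n, hn, rfl⟩
      exact ⟨m * n, M.mul_mem hm hn, by simp [mul_assoc]⟩
    have heE : e ∈ E := ⟨1, M.one_mem, by simp⟩
    have hcc := cent_comm S hE heE hsc
    obtain ⟨v0, hv0⟩ : ∃ v0, e v0 ≠ 0 := by
      by_contra hcon
      push Not at hcon
      exact he0 (LinearMap.ext hcon)
    set v := e v0 with hv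
    have hev : e v = v := hfixr e hee v ⟨v0, rfl⟩
    obtain ⟨φ, hφ, -⟩ := dual_pair (p := (⊥ : Submodule K V)) (v := v) (by simpa using hv0)
    let z : K → Module.End K V := fun k => e * (φ.smulRight (k • v)) * e
    have hz : ∀ k, z k ∈ Subalgebra.centralizer F E := by
      intro k
      rw [Subalgebra.mem_centralizer_iff]
      rintro _ ⟨m, hm, rfl⟩
      have h1 := hinv m hm e he
      have hcm := hcomm _ h1 e he
      rcases hconj m hm with h | h
      · set e' := (m : Module.End K V) * e * ((m⁻¹ : (Module.End K V)ˣ) : Module.End K V)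
        simp only [z]
        rw [mul_assoc e, ← mul_assoc e', hcm, h, mul_assoc e, mul_assoc _ e e', h]
        simp
      · rw [h]
        simp only [z]
        rw [← mul_assoc, ← mul_assoc, hee, mul_assoc _ e e, hee]
    have hzv : ∀ k l : K, z k (l • v) = (l * k) • v := by
      intro k l
      simp [z, hev, hφ, mul_smul]
    obtain ⟨a, b, hab⟩ := S.hnc
    have := congrArg (fun y : Module.End K V => y v) (hcc (z a) (hz a) (z b) (hz b))
    simp only [Module.End.mul_apply] at this
    have hone : ∀ k, z k v = k • v := fun k => by simpa using hzv k 1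
    rw [hone, hone, hzv, hzv] at this
    apply hab
    have h0 : (a * b - b * a) • v = 0 := by rw [sub_smul, this, sub_self]
    exact sub_eq_zero.1 ((smul_eq_zero.1 h0).resolve_right hv0)
  have he1 : e = 1 := by
    obtain ⟨f, hf⟩ := hesc
    haveI : Nontrivial (Module.End K V) := ⟨⟨e, 0, he0⟩⟩
    have : f * f = f := by
      apply (algebraMap F (Module.End K V)).injective
      rw [map_mul, hf, hee]
    have hf0 : f ≠ 0 := by
      rintro rfl
      exact he0 (by rw [← hf, map_zero])
    have : f = 1 := by
      exact mul_left_cancel₀ hf0 (by rw [this, mul_one])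
    rw [← hf, this, map_one]
  intro x hx hx0
  have h1 := hmin' x hx hx0
  have h2 : LinearMap.range x = ⊤ := by
    apply Submodule.eq_top_of_finrank_eq
    apply le_antisymm (Submodule.finrank_le _)
    refine le_trans ?_ h1
    rw [he1] at her
    have : LinearMap.range (1 : Module.End K V) = ⊤ := LinearMap.range_id
    rw [this, finrank_top] at her
    exact her
  rw [Module.End.isUnit_iff]
  have hs := LinearMap.range_eq_top.1 h2
  exact ⟨LinearMap.injective_iff_surjective.2 hs, hs⟩

end PartSeven

section PartEight
variable {F K V : Type*} [Field F] [Infinite F] [DivisionRing K] [Algebra F K] [AddCommGroup V]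
  [Module K V] [Module F V] [IsScalarTower F K V] [Module.Finite K V]
  {G M : Subgroup (Module.End K V)ˣ}

theorem caseI (S : Setup F K V G M) (hnonab : ¬ ∀ x ∈ M, ∀ y ∈ M, x * y = y * x)
    (E0 : Subalgebra F (Module.End K V)) (hE0 : InvM M (E0 : Set (Module.End K V)))
    (hE0c : ∀ x ∈ E0, ∀ y ∈ E0, x * y = y * x) (c0 : Module.End K V) (hc0 : c0 ∈ E0)
    (hsc : ¬ IsSc F c0) :
    ∃ p, Nat.Prime p ∧ Module.finrank F (Module.End K V) = p * p := by
  classical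
  set C := Subalgebra.centralizer F (E0 : Set (Module.End K V)) with hCdef
  have hcomm : ∀ x ∈ C, ∀ y ∈ C, x * y = y * x := cent_comm S hE0 hc0 hsc
  have hinv : InvM M (C : Set (Module.End K V)) := inv_centralizer hE0
  have hE0C : ∀ x ∈ E0, x ∈ C := fun x hx =>
    (Subalgebra.mem_centralizer_iff F).2 fun y hy => hE0c y hy x hx
  have hself : ∀ a : Module.End K V, (∀ x ∈ C, a * x = x * a) → a ∈ C := fun a ha =>
    (Subalgebra.mem_centralizer_iff F).2 fun y hy => (ha y (hE0C y hy)).symm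
  have hunit := units_of_C S C hinv hcomm
  haveI hnt : Nontrivial (Module.End K V) := by
    obtain ⟨u, hu⟩ := exists_ne_zero_v S.h2
    exact ⟨⟨1, 0, fun h => hu (by simpa using congrArg (fun y : Module.End K V => y u) h)⟩⟩
  have hinvC : ∀ x : C, x ≠ 0 → ∃ y : C, x * y = 1 := by
    rintro ⟨x, hx⟩ hx0
    obtain ⟨u, rfl⟩ := hunit x hx (fun h => hx0 (Subtype.ext h))
    refine ⟨⟨((u⁻¹ : (Module.End K V)ˣ) : Module.End K V), hself _ ?_⟩, Subtype.ext (Units.mul_inv u)⟩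
    intro y hy
    have := hcomm _ hx y hy
    rw [Units.inv_mul_eq_iff_eq_mul, ← mul_assoc, this, mul_assoc, Units.mul_inv, mul_one]
  choose! iv hiv using hinvC
  letI : Field C :=
    { (inferInstance : Ring C) with
      mul_comm := fun x y => Subtype.ext (hcomm x.1 x.2 y.1 y.2)
      inv := fun x => if x = 0 then 0 else iv x
      exists_pair_ne := ⟨1, 0, fun h => one_ne_zero (congrArg Subtype.val h)⟩
      mul_inv_cancel := fun x hx => by
        change x * (if x = 0 then 0 else iv x) = 1
        rw [if_neg hx, hiv x hx]
      inv_zero := if_pos rfl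
      nnqsmul := _
      nnqsmul_def := fun _ _ => rfl
      qsmul := _
      qsmul_def := fun _ _ => rfl }
  have hMm : ∀ x ∈ M, ∀ y ∈ M, (x : Module.End K V) * y = y * x → x * y = y * x :=
    fun x _ y _ h => Units.ext h
  haveI : Algebra.IsAlgebraic F C := ⟨fun x =>
    ((isIntegral_algHom_iff C.val Subtype.val_injective).1 (isInt S x.1)).isAlgebraic⟩
  refine crossed_dim (L := C) C.val M S.hsol ?_ ?_ ?_ ?_ ?_
  · intro m hm x
    exact ⟨⟨_, hinv m hm x.1 x.2⟩, rfl⟩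
  · intro a ha
    exact ⟨⟨a, hself a (fun x hx => ha ⟨x, hx⟩)⟩, rfl⟩
  · have hI : InvM M (Set.range C.val ∪ {a | ∃ m ∈ M, (m : Module.End K V) = a}) := by
      rintro m hm _ (⟨x, rfl⟩ | ⟨n, hn, rfl⟩)
      · exact Or.inl ⟨⟨_, hinv m hm x.1 x.2⟩, rfl⟩
      · exact Or.inr ⟨m * n * m⁻¹, M.mul_mem (M.mul_mem hm hn) (M.inv_mem hm), by simp⟩
    rcases star S _ (inv_adjoin (F := F) hI) with h | h
    · exact h
    · exfalso
      apply hnonab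
      intro x hx y hy
      exact hMm x hx y hy (h _ (Algebra.subset_adjoin (Or.inr ⟨x, hx, rfl⟩)) _
        (Algebra.subset_adjoin (Or.inr ⟨y, hy, rfl⟩)))
  · by_contra hcon
    push Not at hcon
    apply hnonab
    intro x hx y hy
    exact hMm x hx y hy (hcomm _ (hself _ (fun z hz => hcon x hx ⟨z, hz⟩)) _
      (hself _ (fun z hz => hcon y hy ⟨z, hz⟩)))
  · rintro N hN hnorm ⟨n0, hn0, x0, hx0⟩ x hx
    by_cases hxs : IsSc F (x : Module.End K V)
    · obtain ⟨f, hf⟩ := hxs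
      exact ⟨f, Subtype.ext hf⟩
    exfalso
    let E : Set (Module.End K V) := {y | y ∈ C ∧ ∀ n ∈ N, (n : Module.End K V) * y = y * n}
    have hE : InvM M E := by
      rintro m hm y ⟨hy, hy'⟩
      refine ⟨hinv m hm y hy, fun n hn => ?_⟩
      have h1 := hy' _ (hnorm m⁻¹ (M.inv_mem hm) n hn)
      have h2 := congrArg (fun z : Module.End K V => (m : Module.End K V) * z *
        ((m⁻¹ : (Module.End K V)ˣ) : Module.End K V)) h1
      simpa [mul_assoc] using h2
    have hcc := cent_comm S hE (c := x.1) ⟨x.2, hx⟩ hxs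
    apply hx0
    refine hcc _ ?_ _ ?_
    · exact (Subalgebra.mem_centralizer_iff F).2 fun y hy => (hy.2 n0 hn0).symm
    · exact (Subalgebra.mem_centralizer_iff F).2 fun y hy => hcomm _ hy.1 _ x0.2

end PartEight

section FinAdj
variable {T A : Type*} [CommRing T] [Ring A] [Algebra T A]

lemma fin_adj (s : Finset A) (hIntegral : ∀ x ∈ s, IsIntegral T x)
    (hc : ∀ x ∈ s, ∀ y ∈ s, ∃ l : T, x * y = l • (y * x)) :
    (Subalgebra.toSubmodule (Algebra.adjoin T (s : Set A))).FG := by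
  classical
  induction s using Finset.induction_on with
  | empty =>
    rw [Finset.coe_empty, Algebra.adjoin_empty]
    exact Subalgebra.fg_bot_toSubmodule
  | insert x s hx ih =>
    have hP := ih (fun y hy => hIntegral y (Finset.mem_insert_of_mem hy))
      (fun y hy z hz => hc y (Finset.mem_insert_of_mem hy) z (Finset.mem_insert_of_mem hz))
    set P := Algebra.adjoin T (s : Set A) with hPdef
    set X := Algebra.adjoin T ({x} : Set A) with hXdef
    have hX : (Subalgebra.toSubmodule X).FG :=
      (hIntegral x (Finset.mem_insert_self x s)).fg_adjoin_singleton
    have h1 : ∀ p ∈ P, ∃ p' ∈ P, x * p = p' * x := by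
      intro p hp
      induction hp using Algebra.adjoin_induction with
      | mem y hy =>
        obtain ⟨l, hl⟩ := hc x (Finset.mem_insert_self x s) y (Finset.mem_insert_of_mem hy)
        exact ⟨l • y, P.smul_mem (Algebra.subset_adjoin hy) l, by rw [hl, smul_mul_assoc]⟩
      | algebraMap r => exact ⟨algebraMap T A r, P.algebraMap_mem r, (Algebra.commutes r x).symm⟩
      | add p q _ _ hp hq =>
        obtain ⟨p', hp', e1⟩ := hp
        obtain ⟨q', hq', e2⟩ := hq
        exact ⟨p' + q', P.add_mem hp' hq', by rw [mul_add, e1, e2, add_mul]⟩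
      | mul p q _ _ hp hq =>
        obtain ⟨p', hp', e1⟩ := hp
        obtain ⟨q', hq', e2⟩ := hq
        exact ⟨p' * q', P.mul_mem hp' hq', by rw [← mul_assoc, e1, mul_assoc, e2, mul_assoc]⟩
    have h2 : ∀ z ∈ X, ∀ p ∈ P, z * p ∈ Subalgebra.toSubmodule P * Subalgebra.toSubmodule X := by
      intro z hz
      induction hz using Algebra.adjoin_induction with
      | mem y hy =>
        intro p hp
        rw [Set.mem_singleton_iff] at hy
        subst hy
        obtain ⟨p', hp', e1⟩ := h1 p hp
        rw [e1]
        exact Submodule.mul_mem_mul hp' (Algebra.subset_adjoin rfl)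
      | algebraMap r =>
        intro p hp
        rw [Algebra.commutes]
        exact Submodule.mul_mem_mul hp (X.algebraMap_mem r)
      | add y z _ _ hy hz =>
        intro p hp
        rw [add_mul]
        exact Submodule.add_mem _ (hy p hp) (hz p hp)
      | mul y z _ hzX hy hz =>
        intro p hp
        rw [mul_assoc]
        have := hz p hp
        generalize z * p = w at this
        induction this using Submodule.mul_induction_on' with
        | mem_mul_mem q hq r hr =>
          rw [← mul_assoc]
          have h3 := Submodule.mul_mem_mul (hy q hq) hr
          rw [mul_assoc, X.isIdempotentElem_toSubmodule.eq] at h3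
          exact h3
        | add q _ r _ h3 h4 =>
          rw [mul_add]
          exact Submodule.add_mem _ h3 h4
    have h3 : Subalgebra.toSubmodule X * Subalgebra.toSubmodule P ≤
        Subalgebra.toSubmodule P * Subalgebra.toSubmodule X := Submodule.mul_le.2 h2
    have hQ1 : (1 : A) ∈ Subalgebra.toSubmodule P * Subalgebra.toSubmodule X := by
      have := Submodule.mul_mem_mul (M := Subalgebra.toSubmodule P) (N := Subalgebra.toSubmodule X)
        P.one_mem X.one_mem
      simpa using this
    have hQm : ∀ y z, y ∈ Subalgebra.toSubmodule P * Subalgebra.toSubmodule X →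
        z ∈ Subalgebra.toSubmodule P * Subalgebra.toSubmodule X →
        y * z ∈ Subalgebra.toSubmodule P * Subalgebra.toSubmodule X := by
      intro y z hy hz
      have h4 := Submodule.mul_mem_mul hy hz
      have h5 : Subalgebra.toSubmodule P * Subalgebra.toSubmodule X *
          (Subalgebra.toSubmodule P * Subalgebra.toSubmodule X) ≤
          Subalgebra.toSubmodule P * Subalgebra.toSubmodule X := by
        calc Subalgebra.toSubmodule P * Subalgebra.toSubmodule X *
          (Subalgebra.toSubmodule P * Subalgebra.toSubmodule X)
          = Subalgebra.toSubmodule P * (Subalgebra.toSubmodule X *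
          Subalgebra.toSubmodule P) * Subalgebra.toSubmodule X := by simp only [mul_assoc]
          _ ≤ Subalgebra.toSubmodule P * (Subalgebra.toSubmodule P *
          Subalgebra.toSubmodule X) * Subalgebra.toSubmodule X := by gcongr
          _ = (Subalgebra.toSubmodule P * Subalgebra.toSubmodule P) *
          (Subalgebra.toSubmodule X * Subalgebra.toSubmodule X) := by simp only [mul_assoc]
          _ = _ := by rw [P.isIdempotentElem_toSubmodule.eq, X.isIdempotentElem_toSubmodule.eq]
      exact h5 h4
    have heq : Subalgebra.toSubmodule (Algebra.adjoin T ((insert x s : Finset A) : Set A)) =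
        Subalgebra.toSubmodule P * Subalgebra.toSubmodule X := by
      apply le_antisymm
      · have : Algebra.adjoin T ((insert x s : Finset A) : Set A) ≤
            Submodule.toSubalgebra _ hQ1 hQm := by
          rw [Algebra.adjoin_le_iff]
          intro y hy
          rw [Finset.coe_insert] at hy
          rcases hy with rfl | hy
          · have := Submodule.mul_mem_mul (M := Subalgebra.toSubmodule P)
              (N := Subalgebra.toSubmodule X) P.one_mem (Algebra.subset_adjoin rfl)
            rw [one_mul] at this
            exact this
          · have := Submodule.mul_mem_mul (M := Subalgebra.toSubmodule P)
              (N := Subalgebra.toSubmodule X) (Algebra.subset_adjoin hy) X.one_mem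
            rw [mul_one] at this
            exact this
        exact this
      · rw [Submodule.mul_le]
        intro p hp z hz
        refine Subalgebra.mul_mem _ ?_ ?_
        · exact Algebra.adjoin_mono (by simp) hp
        · exact Algebra.adjoin_mono (by simp) hz
    rw [heq]
    exact hP.mul hX

end FinAdj

section FinT

lemma jac_int : IsJacobsonRing ℤ := by
  rw [isJacobsonRing_iff_prime_eq]
  intro P hP
  by_cases hb : P = ⊥
  · subst hb
    rw [eq_bot_iff]
    intro x hx
    rw [Ideal.mem_jacobson_bot] at hx
    have := hx x
    rw [Int.isUnit_iff] at this
    rw [Ideal.mem_bot]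
    rcases this with h | h <;> nlinarith
  · have := hP.isMaximal hb
    exact Ideal.jacobson_eq_self_of_isMaximal

lemma finite_field_ft (T : Type*) [Field T] [Algebra.FiniteType ℤ T] : Finite T := by
  have := jac_int
  have hfin := finite_of_finite_type_of_isJacobsonRing ℤ T
  apply Module.finite_of_fg_torsion
  have hni : ¬ Function.Injective (algebraMap ℤ T) := by
    intro hinj
    exact Int.not_isField (isField_of_isIntegral_of_isField hinj (Field.toIsField T))
  rw [injective_iff_map_eq_zero] at hni
  push Not at hni
  obtain ⟨n, hn, hn0⟩ := hni
  intro x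
  refine ⟨⟨n, mem_nonZeroDivisors_of_ne_zero hn0⟩, ?_⟩
  change n • x = 0
  rw [Algebra.smul_def, hn, zero_mul]

lemma finite_of_integral {F : Type*} [Field F] (s : Set F) (hs : s.Finite)
    (h : ∀ f : F, IsIntegral (Subring.closure s) f) : Finite (Subring.closure s) := by
  have h1 : Algebra.FiniteType ℤ (Subring.closure s) :=
    (Algebra.FiniteType.adjoin_of_finite (R := ℤ) hs).equiv (Subring.closureEquivAdjoinInt s).symm
  have : Algebra.IsIntegral (Subring.closure s) F := ⟨h⟩
  have hF : IsField (Subring.closure s) := isField_of_isIntegral_of_isField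
    (S := F) Subtype.val_injective (Field.toIsField F)
  exact @finite_field_ft _ hF.toField h1

end FinT

lemma comm_of_locally {F K : Type*} [Field F] [DivisionRing K] [Algebra F K]
    (hT : ∀ s : Set F, s.Finite → Finite (Subring.closure s)) (a b : K)
    (hloc : Module.Finite F (Algebra.adjoin F ({a, b} : Set K))) : a * b = b * a := by
  set B := Algebra.adjoin F ({a, b} : Set K) with hB
  let e := Module.finBasis F B
  let a' : B := ⟨a, Algebra.subset_adjoin (by simp)⟩
  let b' : B := ⟨b, Algebra.subset_adjoin (by simp)⟩
  let Y : Set B := Set.range (fun p : Fin _ × Fin _ => e p.1 * e p.2) ∪ {a', b', 1}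
  let cs : Set F := Set.image2 (fun y k => e.repr y k) Y Set.univ
  have hY : Y.Finite := (Set.finite_range _).union (Set.toFinite _)
  have hcs : cs.Finite := hY.image2 _ Set.finite_univ
  haveI := hT cs hcs
  set T := Subring.closure cs with hTd
  let R := Submodule.span T (Set.range (fun i => (e i : K)))
  have hR : ∀ y ∈ Y, (y : K) ∈ R := by
    intro y hy
    have h1 := e.sum_repr y
    have h2 : (y : K) = ∑ i, e.repr y i • (e i : K) := by
      have h3 := congrArg B.val h1
      rw [map_sum] at h3
      exact h3.symm
    rw [h2]
    refine Submodule.sum_mem _ fun i _ => ?_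
    have : e.repr y i ∈ T := Subring.subset_closure ⟨y, hy, i, trivial, rfl⟩
    exact R.smul_mem (⟨_, this⟩ : T) (Submodule.subset_span ⟨i, rfl⟩)
  have hRm : ∀ y z, y ∈ R → z ∈ R → y * z ∈ R := by
    have : R * R ≤ R := by
      change Submodule.span T _ * Submodule.span T _ ≤ _
      rw [Submodule.span_mul_span, Submodule.span_le]
      rintro _ ⟨_, ⟨i, rfl⟩, _, ⟨j, rfl⟩, rfl⟩
      exact hR (e i * e j) (Or.inl ⟨(i, j), rfl⟩)
    exact fun y z hy hz => this (Submodule.mul_mem_mul hy hz)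
  have hR1 : (1 : K) ∈ R := hR 1 (Or.inr (by simp))
  let Q : Subalgebra T K := Submodule.toSubalgebra R hR1 hRm
  haveI : Module.Finite T R := Module.Finite.span_of_finite T (Set.finite_range _)
  haveI : Finite R := Module.finite_of_finite T
  haveI : Finite Q := this
  have hf := Finite.isDomain_to_isField Q
  have := hf.mul_comm (⟨a, hR a' (Or.inr (by simp))⟩ : Q) ⟨b, hR b' (Or.inr (by simp))⟩
  exact congrArg Subtype.val this

lemma root_pow {F A : Type*} [Field F] [Ring A] [Nontrivial A] [Algebra F A] (b y : Aˣ) (l : F)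
    (hIntegral : IsIntegral F (b : A)) (h : (y : A) * b = l • ((b : A) * y)) :
    l ^ (minpoly F (b : A)).natDegree = 1 := by
  set p := minpoly F (b : A) with hp
  have hp0 : p ≠ 0 := minpoly.ne_zero hIntegral
  have hmon : p.Monic := minpoly.monic hIntegral
  let φ : A →ₐ[F] A :=
    { toFun := fun a => y * a * ((y⁻¹ : Aˣ) : A)
      map_one' := by simp
      map_mul' := fun a c => by simp [mul_assoc]
      map_zero' := by simp
      map_add' := fun a c => by simp [mul_add, add_mul]
      commutes' := fun r => by
        rw [← Algebra.commutes, mul_assoc, Units.mul_inv, mul_one] }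
  have hφ : φ b = l • (b : A) := by
    change (y : A) * b * ((y⁻¹ : Aˣ) : A) = _
    rw [h, smul_mul_assoc, mul_assoc, Units.mul_inv, mul_one]
  have h1 : Polynomial.aeval (l • (b : A)) p = 0 := by
    rw [← hφ, Polynomial.aeval_algHom_apply, hp, minpoly.aeval, map_zero]
  have h2 : Polynomial.aeval (b : A) (p.comp (Polynomial.C l * Polynomial.X)) = 0 := by
    rw [Polynomial.aeval_comp]
    simpa [Algebra.smul_def] using h1
  set r := p.comp (Polynomial.C l * Polynomial.X) - Polynomial.C (l ^ p.natDegree) * p with hr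
  have hrc : ∀ i, r.coeff i = p.coeff i * l ^ i - l ^ p.natDegree * p.coeff i := by
    intro i
    rw [hr, Polynomial.coeff_sub, Polynomial.comp_C_mul_X_coeff, Polynomial.coeff_C_mul]
  have hra : Polynomial.aeval (b : A) r = 0 := by
    rw [hr, map_sub, h2, map_mul, hp, minpoly.aeval, mul_zero, sub_zero]
  have hr0 : r = 0 := by
    by_contra hne
    have h3 := minpoly.degree_le_of_ne_zero F (b : A) hne hra
    rw [← hp] at h3
    have h4 : r.degree < p.natDegree := by
      rw [Polynomial.degree_lt_iff_coeff_zero]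
      intro i hi
      rw [hrc]
      rcases hi.eq_or_lt with rfl | hlt
      · ring
      · rw [Polynomial.coeff_eq_zero_of_natDegree_lt hlt]; ring
    rw [← Polynomial.degree_eq_natDegree hp0] at h4
    exact absurd h3 (not_le.2 h4)
  have hc0 : p.coeff 0 ≠ 0 := by
    intro hz
    obtain ⟨q, hq⟩ := Polynomial.X_dvd_iff.2 hz
    have hq0 : q ≠ 0 := by
      rintro rfl
      exact hp0 (by rw [hq, mul_zero])
    have h5 : Polynomial.aeval (b : A) q = 0 := by
      have : (b : A) * Polynomial.aeval (b : A) q = 0 := by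
        have h6 := minpoly.aeval F (b : A)
        rw [← hp, hq, map_mul, Polynomial.aeval_X] at h6
        exact h6
      exact (Units.mul_right_eq_zero b).1 this
    have h7 := minpoly.degree_le_of_ne_zero F (b : A) hq0 h5
    rw [← hp, hq, mul_comm, Polynomial.degree_mul_X, Polynomial.degree_eq_natDegree hq0] at h7
    norm_cast at h7
    omega
  have h8 := hrc 0
  rw [hr0, Polynomial.coeff_zero, pow_zero, mul_one] at h8
  have h9 : p.coeff 0 * (1 - l ^ p.natDegree) = 0 := by rw [h8]; ring
  exact (sub_eq_zero.1 ((mul_eq_zero.1 h9).resolve_left hc0)).symm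

lemma adj_coeff {F A : Type*} [Field F] [Ring A] [Algebra F A] (X : Set A) (a : A)
    (ha : a ∈ Algebra.adjoin F X) :
    ∃ s : Finset F, ∀ T : Subring F, (s : Set F) ⊆ T → a ∈ Algebra.adjoin T X := by
  classical
  induction ha using Algebra.adjoin_induction with
  | mem x hx => exact ⟨∅, fun T _ => Algebra.subset_adjoin hx⟩
  | algebraMap r =>
    refine ⟨{r}, fun T hT => ?_⟩
    have hr : r ∈ T := hT (by simp)
    exact Subalgebra.algebraMap_mem _ (⟨r, hr⟩ : T)
  | add x y _ _ hx hy =>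
    obtain ⟨s, hs⟩ := hx
    obtain ⟨t, ht⟩ := hy
    refine ⟨s ∪ t, fun T hT => ?_⟩
    rw [Finset.coe_union, Set.union_subset_iff] at hT
    exact Subalgebra.add_mem _ (hs T hT.1) (ht T hT.2)
  | mul x y _ _ hx hy =>
    obtain ⟨s, hs⟩ := hx
    obtain ⟨t, ht⟩ := hy
    refine ⟨s ∪ t, fun T hT => ?_⟩
    rw [Finset.coe_union, Set.union_subset_iff] at hT
    exact Subalgebra.mul_mem _ (hs T hT.1) (ht T hT.2)

lemma adj_fin {T A : Type*} [CommRing T] [Ring A] [Algebra T A] (X : Set A) (a : A)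
    (ha : a ∈ Algebra.adjoin T X) :
    ∃ s : Finset A, (s : Set A) ⊆ X ∧ a ∈ Algebra.adjoin T (s : Set A) := by
  classical
  induction ha using Algebra.adjoin_induction with
  | mem x hx => exact ⟨{x}, by simpa using hx, Algebra.subset_adjoin (by simp)⟩
  | algebraMap r => exact ⟨∅, by simp, Subalgebra.algebraMap_mem _ r⟩
  | add x y _ _ hx hy =>
    obtain ⟨s, hs, hs'⟩ := hx
    obtain ⟨t, ht, ht'⟩ := hy
    exact ⟨s ∪ t, by simp [hs, ht], Subalgebra.add_mem _
      (Algebra.adjoin_mono (by simp) hs') (Algebra.adjoin_mono (by simp) ht')⟩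
  | mul x y _ _ hx hy =>
    obtain ⟨s, hs, hs'⟩ := hx
    obtain ⟨t, ht, ht'⟩ := hy
    exact ⟨s ∪ t, by simp [hs, ht], Subalgebra.mul_mem _
      (Algebra.adjoin_mono (by simp) hs') (Algebra.adjoin_mono (by simp) ht')⟩

lemma int_of_fg {T A : Type*} [CommRing T] [Ring A] [Algebra T A] (B : Subalgebra T A)
    (hB : (Subalgebra.toSubmodule B).FG) (x : A) (hx : x ∈ B) : IsIntegral T x := by
  have : Module.Finite T B := Module.Finite.iff_fg.2 hB
  have h := IsIntegral.of_finite T (⟨x, hx⟩ : B)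
  exact h.map B.val

section PartTen
variable {F K V : Type*} [Field F] [Infinite F] [DivisionRing K] [Algebra F K] [AddCommGroup V]
  [Module K V] [Module F V] [IsScalarTower F K V] [Module.Finite K V]
  {G M : Subgroup (Module.End K V)ˣ}

lemma inv_adjoinT {T : Type*} [CommRing T] [Algebra T (Module.End K V)]
    {E : Set (Module.End K V)} (hE : InvM M E) :
    InvM M (Algebra.adjoin T E : Set (Module.End K V)) := by
  intro m hm x hx
  induction hx using Algebra.adjoin_induction with
  | mem x hx => exact Algebra.subset_adjoin (hE m hm x hx)
  | algebraMap r =>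
    rw [← Algebra.commutes, mul_assoc, Units.mul_inv, mul_one]
    exact Subalgebra.algebraMap_mem _ r
  | add x y _ _ h1 h2 =>
    rw [mul_add, add_mul]
    exact Subalgebra.add_mem _ h1 h2
  | mul x y _ _ h1 h2 =>
    have := Subalgebra.mul_mem _ h1 h2
    simpa [mul_assoc] using this

/-- integrality of the ground field over a finitely generated subring. -/
lemma caseII_int (S : Setup F K V G M) (X : Set (Module.End K V)) (hXinv : InvM M X)
    (b : (Module.End K V)ˣ) (hbX : (b : Module.End K V) ∈ X) (hbsc : ¬ IsSc F (b : Module.End K V))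
    (hXtop : Algebra.adjoin F X = ⊤) (d : ℕ) (hd : 0 < d) (β : F) (hβ : β ≠ 0)
    (hpow : ∀ x ∈ X, x ^ d = algebraMap F (Module.End K V) β)
    (hcom : ∀ x ∈ X, ∀ y ∈ X, ∃ l : F, l ^ d = 1 ∧ x * y = l • (y * x))
    (s : Set F) (hs : s.Finite) : Finite (Subring.closure s) := by
  classical
  haveI hnt : Nontrivial (Module.End K V) := by
    obtain ⟨u, hu⟩ := exists_ne_zero_v S.h2
    exact ⟨⟨1, 0, fun h => hu (by simpa using congrArg (fun y : Module.End K V => y u) h)⟩⟩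
  obtain ⟨g, hgG, hgM⟩ : ∃ g ∈ G, g ∉ M := by
    by_contra hcon
    push Not at hcon
    exact S.hne (le_antisymm S.hMG hcon)
  obtain ⟨s1, hs1⟩ := adj_coeff X (g : Module.End K V) (by rw [hXtop]; trivial : _ ∈ Algebra.adjoin F X)
  obtain ⟨s2, hs2⟩ := adj_coeff X ((g⁻¹ : (Module.End K V)ˣ) : Module.End K V) (by rw [hXtop]; trivial : _ ∈ Algebra.adjoin F X)
  let t : Set F := s ∪ s1 ∪ s2 ∪ {β, β⁻¹} ∪ ((Polynomial.nthRoots d (1 : F)).toFinset : Set F)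
  have ht : t.Finite := (((hs.union s1.finite_toSet).union s2.finite_toSet).union
    (Set.toFinite _)).union (Finset.finite_toSet _)
  set T := Subring.closure t with hT
  have htT : t ⊆ T := Subring.subset_closure
  have hroot : ∀ l : F, l ^ d = 1 → l ∈ T := fun l hl => htT (Or.inr (by
    simp [Polynomial.mem_nthRoots hd, hl]))
  have hβT : β ∈ T := htT (Or.inl (Or.inr (by simp)))
  have hβT' : β⁻¹ ∈ T := htT (Or.inl (Or.inr (by simp)))
  have hsm : ∀ (l : T) (x : Module.End K V), (l : F) • x = l • x := fun l x => rfl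
  set R := Algebra.adjoin T X with hR
  have hg1 : (g : Module.End K V) ∈ R := hs1 T (fun x hx => htT (by simp [t, Finset.mem_coe.1 hx]))
  have hg2 : ((g⁻¹ : (Module.End K V)ˣ) : Module.End K V) ∈ R :=
    hs2 T (fun x hx => htT (by simp [t, Finset.mem_coe.1 hx]))
  have hRinv : InvM M (R : Set (Module.End K V)) := inv_adjoinT hXinv
  have hNG : NG G (R : Set (Module.End K V)) = G := by
    rcases NG_cases S hRinv with h | h
    · exfalso
      apply hgM
      rw [← h]
      exact ⟨hgG, fun c hc => R.mul_mem (R.mul_mem hg1 hc) hg2,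
        fun c hc => R.mul_mem (R.mul_mem hg2 hc) hg1⟩
    · exact h
  have hbR : (b : Module.End K V) ∈ R := Algebra.subset_adjoin hbX
  have hbR' : ((b⁻¹ : (Module.End K V)ˣ) : Module.End K V) ∈ R := by
    have h1 : ((b⁻¹ : (Module.End K V)ˣ) : Module.End K V) =
        (⟨β⁻¹, hβT'⟩ : T) • (b : Module.End K V) ^ (d - 1) := by
      rw [Units.inv_eq_of_mul_eq_one_right]
      change (b : Module.End K V) * (β⁻¹ • (b : Module.End K V) ^ (d - 1)) = 1
      rw [mul_smul_comm, ← pow_succ', Nat.sub_add_cancel hd, hpow _ hbX, Algebra.smul_def,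
        ← map_mul, inv_mul_cancel₀ hβ, map_one]
    rw [h1]
    exact R.smul_mem (R.pow_mem hbR _) _
  have hRtop : R.toSubring = ⊤ := by
    apply subring_top_of_eg S.h2
    obtain ⟨a, ha, ha2⟩ := exists_a F K
    obtain ⟨v0, hv0⟩ := exists_of_not_sc S _ hbsc
    have hle : Eg K V ≤ UC R.toSubring := by
      refine eg_T1 S.h2 ha ha2 (UC R.toSubring) ?_ b ⟨hbR, hbR'⟩ v0 hv0
      intro e he h hh
      have heN : e ∈ NG G (R : Set (Module.End K V)) := by
        rw [hNG]; exact S.hEG he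
      refine ⟨?_, ?_⟩
      · exact heN.2.1 _ hh.1
      · have := heN.2.1 _ hh.2
        simpa [mul_assoc] using this
    exact fun e he => (hle he).1
  have hIntegral : ∀ f : F, IsIntegral T f := by
    intro f
    have hf : algebraMap F (Module.End K V) f ∈ R := by
      have : algebraMap F (Module.End K V) f ∈ R.toSubring := by rw [hRtop]; trivial
      exact this
    obtain ⟨X0, hX0, hf0⟩ := adj_fin X _ hf
    have hfg := fin_adj (T := T) X0 (by
      intro x hx
      apply IsIntegral.of_pow hd
      rw [hpow x (hX0 hx)]
      exact isIntegral_algebraMap (R := T) (A := Module.End K V) (x := ⟨β, hβT⟩)) (by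
      intro x hx y hy
      obtain ⟨l, hl, e⟩ := hcom x (hX0 hx) y (hX0 hy)
      exact ⟨⟨l, hroot l hl⟩, e⟩)
    have h1 := int_of_fg _ hfg _ hf0
    exact (isIntegral_algHom_iff (IsScalarTower.toAlgHom T F (Module.End K V))
      (algebraMap F (Module.End K V)).injective).1 h1
  have hfin := finite_of_integral t ht hIntegral
  have hle : Subring.closure s ≤ Subring.closure t :=
    Subring.closure_mono (fun x hx => by simp [t, hx])
  exact Finite.of_injective (Subring.inclusion hle) (Subring.inclusion_injective hle)

theorem caseII (S : Setup F K V G M) (hnonab : ¬ ∀ x ∈ M, ∀ y ∈ M, x * y = y * x)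
    (hlocK : ∀ a b : K, Module.Finite F (Algebra.adjoin F ({a, b} : Set K)))
    (hII : ∀ E0 : Subalgebra F (Module.End K V), InvM M (E0 : Set (Module.End K V)) →
      (∀ x ∈ E0, ∀ y ∈ E0, x * y = y * x) → ∀ c ∈ E0, IsSc F c) : False := by
  classical
  haveI hnt : Nontrivial (Module.End K V) := by
    obtain ⟨u, hu⟩ := exists_ne_zero_v S.h2
    exact ⟨⟨1, 0, fun h => hu (by simpa using congrArg (fun y : Module.End K V => y u) h)⟩⟩
  have := S.hsol
  let Z : Subgroup M :=
    { carrier := {m | ∀ x : Module.End K V, ((m : (Module.End K V)ˣ) : Module.End K V) * x =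
        x * ((m : (Module.End K V)ˣ) : Module.End K V)}
      one_mem' := fun x => by simp
      mul_mem' := fun {a c} ha hc x => by
        rw [Subgroup.coe_mul, Units.val_mul, mul_assoc, hc x, ← mul_assoc, ha x, mul_assoc]
      inv_mem' := fun {a} ha x => by
        rw [Subgroup.coe_inv, Units.inv_mul_eq_iff_eq_mul, ← mul_assoc, ha x, mul_assoc,
          Units.mul_inv, mul_one] }
  obtain ⟨N, hN, ⟨b, hbN, hbZ⟩, hNc⟩ := exists_derived_step Z (by
    intro h
    apply hnonab
    intro x hx y hy
    exact Units.ext (h ⟨x, hx⟩ y))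
  have hbsc : ¬ IsSc F ((b : (Module.End K V)ˣ) : Module.End K V) := by
    rintro ⟨f, hf⟩
    apply hbZ
    intro x
    rw [← hf, Algebra.commutes]
  set d := (minpoly F ((b : (Module.End K V)ˣ) : Module.End K V)).natDegree with hd
  have hdpos : 0 < d := minpoly.natDegree_pos (isInt S _)
  have hb : ∀ y ∈ N, ∃ l : F, l ^ d = 1 ∧ ((y : (Module.End K V)ˣ) : Module.End K V) * (b : (Module.End K V)ˣ) =
      l • (((b : (Module.End K V)ˣ) : Module.End K V) * (y : (Module.End K V)ˣ)) := by
    intro y hy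
    obtain ⟨l, hl⟩ := isSc_of_central S _ (hNc y hy b hbN)
    have h1 : ((y : (Module.End K V)ˣ) : Module.End K V) * (b : (Module.End K V)ˣ) =
      l • (((b : (Module.End K V)ˣ) : Module.End K V) * (y : (Module.End K V)ˣ)) := by
      rw [Algebra.smul_def, hl, ← Units.val_mul, ← Units.val_mul, ← Units.val_mul,
        ← Subgroup.coe_mul, ← Subgroup.coe_mul, ← Subgroup.coe_mul]
      congr 2
      group
    exact ⟨l, root_pow _ _ l (isInt S _) h1, h1⟩
  let X : Set (Module.End K V) := {x | ∃ m : M, x = ((m * b * m⁻¹ : M) : (Module.End K V)ˣ)}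
  have hXN : ∀ m : M, m * b * m⁻¹ ∈ N := fun m => hN.conj_mem b hbN m
  have hXinv : InvM M X := by
    rintro m hm _ ⟨n, rfl⟩
    exact ⟨⟨m, hm⟩ * n, by simp [mul_assoc]⟩
  have hbX : ((b : (Module.End K V)ˣ) : Module.End K V) ∈ X := ⟨1, by simp⟩
  have hXtop : Algebra.adjoin F X = ⊤ := by
    rcases star S _ (inv_adjoin (F := F) hXinv) with h | h
    · exact h
    · exact absurd (hII _ (inv_adjoin hXinv) h _ (Algebra.subset_adjoin hbX)) hbsc
  have hyx : ∀ y ∈ N, ∀ m : M, ∃ l : F, l ^ d = 1 ∧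
      ((y : (Module.End K V)ˣ) : Module.End K V) * ((m * b * m⁻¹ : M) : (Module.End K V)ˣ) =
      l • ((((m * b * m⁻¹ : M) : (Module.End K V)ˣ) : Module.End K V) * (y : (Module.End K V)ˣ)) := by
    intro y hy m
    obtain ⟨l, hl, h1⟩ := hb (m⁻¹ * y * m) (by simpa using hN.conj_mem y hy m⁻¹)
    refine ⟨l, hl, ?_⟩
    have h2 := congrArg (fun z : Module.End K V => ((m : (Module.End K V)ˣ) : Module.End K V) * z *
      (((m : (Module.End K V)ˣ)⁻¹ : (Module.End K V)ˣ) : Module.End K V)) h1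
    simpa [mul_assoc] using h2
  have hcom : ∀ x ∈ X, ∀ y ∈ X, ∃ l : F, l ^ d = 1 ∧ x * y = l • (y * x) := by
    rintro _ ⟨m, rfl⟩ _ ⟨n, rfl⟩
    exact hyx _ (hXN m) n
  have hbd : ∀ y ∈ N, ∀ k : ℕ, ∀ l : F, ((y : (Module.End K V)ˣ) : Module.End K V) * (b : (Module.End K V)ˣ) =
      l • (((b : (Module.End K V)ˣ) : Module.End K V) * (y : (Module.End K V)ˣ)) →
      ((y : (Module.End K V)ˣ) : Module.End K V) * ((b : (Module.End K V)ˣ) : Module.End K V) ^ k =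
      l ^ k • (((b : (Module.End K V)ˣ) : Module.End K V) ^ k * (y : (Module.End K V)ˣ)) := by
    intro y hy k l h
    induction k with
    | zero => simp
    | succ k ih =>
      rw [pow_succ, ← mul_assoc, ih, smul_mul_assoc, mul_assoc, h, mul_smul_comm, smul_smul,
        ← pow_succ, mul_assoc]
  obtain ⟨β, hβ⟩ : IsSc F (((b : (Module.End K V)ˣ) : Module.End K V) ^ d) := by
    apply isSc_of_central S
    have hcen : Algebra.adjoin F X ≤
        Subalgebra.centralizer F {((b : (Module.End K V)ˣ) : Module.End K V) ^ d} := by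
      rw [Algebra.adjoin_le_iff]
      rintro _ ⟨m, rfl⟩
      rw [SetLike.mem_coe, Subalgebra.mem_centralizer_iff]
      rintro _ rfl
      obtain ⟨l, hl, h1⟩ := hb _ (hXN m)
      rw [hbd _ (hXN m) d l h1, hl, one_smul]
    intro x
    have : x ∈ Algebra.adjoin F X := by rw [hXtop]; trivial
    exact (Subalgebra.mem_centralizer_iff F).1 (hcen this) _ rfl
  have hβ0 : β ≠ 0 := by
    rintro rfl
    rw [map_zero] at hβ
    exact (Units.isUnit (b : (Module.End K V)ˣ)).pow d |>.ne_zero hβ.symm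
  have hpow : ∀ x ∈ X, x ^ d = algebraMap F (Module.End K V) β := by
    rintro _ ⟨m, rfl⟩
    rw [← Units.val_pow_eq_pow_val, ← Subgroup.coe_pow, conj_pow, Subgroup.coe_mul, Subgroup.coe_mul,
      Units.val_mul, Units.val_mul, Subgroup.coe_pow, Units.val_pow_eq_pow_val, ← hβ,
      ← Algebra.commutes, mul_assoc, Subgroup.coe_inv, Units.mul_inv, mul_one]
  have hfin := caseII_int S X hXinv b hbX hbsc hXtop d hdpos β hβ0 hpow hcom
  obtain ⟨p, q, hpq⟩ := S.hnc
  exact hpq (comm_of_locally hfin p q (hlocK p q))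

end PartTen

section PartEleven

lemma fin_of_le {F A : Type*} [Field F] [Ring A] [Algebra F A] {B C : Subalgebra F A}
    (h : B ≤ C) (hC : Module.Finite F C) : Module.Finite F B := by
  have : FiniteDimensional F (Subalgebra.toSubmodule C) := hC
  exact Submodule.finiteDimensional_of_le (S₁ := Subalgebra.toSubmodule B)
    (S₂ := Subalgebra.toSubmodule C) h

variable {F D : Type*} [Field F] [DivisionRing D] [Algebra F D]

lemma fin_op (hloc : ∀ s : Finset D, Module.Finite F (Algebra.adjoin F (s : Set D)))
    (a b : Dᵐᵒᵖ) : Module.Finite F (Algebra.adjoin F ({a, b} : Set Dᵐᵒᵖ)) := by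
  classical
  have h1 := hloc {a.unop, b.unop}
  have h2 : Module.Finite F (Algebra.adjoin F
      ((({a.unop, b.unop} : Finset D)) : Set D)).op :=
    Module.Finite.equiv (Subalgebra.linearEquivOp _)
  refine fin_of_le ?_ h2
  rw [Algebra.adjoin_le_iff]
  rintro x (rfl | rfl)
  · exact Algebra.subset_adjoin (by simp)
  · exact Algebra.subset_adjoin (by simp)

lemma fin_mat (hloc : ∀ s : Finset D, Module.Finite F (Algebra.adjoin F (s : Set D))) (n : ℕ)
    (s : Finset (Matrix (Fin n) (Fin n) D)) :
    Module.Finite F (Algebra.adjoin F (s : Set (Matrix (Fin n) (Fin n) D))) := by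
  classical
  let t : Finset D := s.biUnion fun m => Finset.univ.image fun ij : Fin n × Fin n => m ij.1 ij.2
  have h1 := hloc t
  let B := Algebra.adjoin F (t : Set D)
  let φ : Matrix (Fin n) (Fin n) B →ₐ[F] Matrix (Fin n) (Fin n) D := B.val.mapMatrix
  have h2 : Module.Finite F φ.range :=
    Module.Finite.of_surjective φ.rangeRestrict.toLinearMap φ.rangeRestrict_surjective
  refine fin_of_le ?_ h2
  rw [Algebra.adjoin_le_iff]
  intro m hm
  refine ⟨Matrix.of fun i j => ⟨m i j, Algebra.subset_adjoin ?_⟩, ?_⟩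
  · simp only [t, Finset.coe_biUnion, Set.mem_iUnion]
    exact ⟨m, hm, by simpa using ⟨i, j, rfl⟩⟩
  · ext i j
    rfl

lemma fin_transfer {A B : Type*} [Ring A] [Ring B] [Algebra F A] [Algebra F B] (e : A ≃ₐ[F] B)
    (h : ∀ s : Finset A, Module.Finite F (Algebra.adjoin F (s : Set A))) (s : Finset B) :
    Module.Finite F (Algebra.adjoin F (s : Set B)) := by
  classical
  have h1 := h (s.image e.symm)
  have h2 : Module.Finite F ((Algebra.adjoin F ((s.image e.symm : Finset _) : Set A)).map
      (e : A →ₐ[F] B)) :=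
    Module.Finite.equiv
      (Subalgebra.equivMapOfInjective _ (e : A →ₐ[F] B) e.injective).toLinearEquiv
  refine fin_of_le ?_ h2
  rw [Algebra.adjoin_le_iff]
  intro m hm
  exact ⟨e.symm m, Algebra.subset_adjoin (by simpa using hm), by simp⟩

lemma fin_end (hloc : ∀ s : Finset D, Module.Finite F (Algebra.adjoin F (s : Set D))) (n : ℕ)
    (s : Finset (Module.End Dᵐᵒᵖ (Fin n → D))) :
    Module.Finite F (Algebra.adjoin F (s : Set (Module.End Dᵐᵒᵖ (Fin n → D)))) :=
  fin_transfer (matEquiv F D n) (fin_mat hloc n) s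

theorem final_abs (hcent : ∀ c : D, (∀ x, c * x = x * c) → ∃ f, algebraMap F D f = c)
    (hloc : ∀ s : Finset D, Module.Finite F (Algebra.adjoin F (s : Set D)))
    (hnc : ∃ a b : D, a * b ≠ b * a) (n : ℕ) (hn : 2 ≤ n)
    (G M : Subgroup (Module.End Dᵐᵒᵖ (Fin n → D))ˣ) (k : ℕ)
    (s : ℕ → Subgroup (Module.End Dᵐᵒᵖ (Fin n → D))ˣ) (hs0 : s 0 = G) (hsk : s k = ⊤)
    (hs : ∀ i < k, s i ≤ s (i + 1) ∧ ((s i).subgroupOf (s (i + 1))).Normal)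
    (hMG : M ≤ G) (hne : M ≠ G)
    (hmax : ∀ H, M ≤ H → H ≤ G → H = M ∨ H = G) (hsol : Group.IsSolvable M)
    (hnonab : ¬ ∀ x ∈ M, ∀ y ∈ M, x * y = y * x) : False := by
  classical
  have hinf : Infinite F := by
    by_contra hfin
    rw [not_infinite_iff_finite] at hfin
    obtain ⟨a, b, hab⟩ := hnc
    refine hab (comm_of_locally (F := F) (fun s _ => inferInstance) a b ?_)
    have := hloc {a, b}
    rwa [Finset.coe_pair] at this
  have h2 := span_ne_top D n hn
  obtain ⟨a, ha, ha2⟩ := exists_a F Dᵐᵒᵖ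
  have hEG : Eg Dᵐᵒᵖ (Fin n → D) ≤ G := by
    by_cases hall : ∀ g ∈ G, ∀ v : Fin n → D,
        (g : Module.End Dᵐᵒᵖ (Fin n → D)) v ∈ Submodule.span Dᵐᵒᵖ {v}
    · exfalso
      apply hnonab
      intro x hx y hy
      obtain ⟨c, -, hc⟩ := scalar_of_span h2 _ (hall x (hMG hx))
      obtain ⟨d, hd, hd'⟩ := scalar_of_span h2 _ (hall y (hMG hy))
      ext1
      refine LinearMap.ext fun v => ?_
      change (x : Module.End Dᵐᵒᵖ (Fin n → D)) ((y : Module.End Dᵐᵒᵖ (Fin n → D)) v) =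
        (y : Module.End Dᵐᵒᵖ (Fin n → D)) ((x : Module.End Dᵐᵒᵖ (Fin n → D)) v)
      rw [hd' v, hd', hc, hc, smul_smul, smul_smul, hd]
    · push Not at hall
      obtain ⟨g, hg, v, hv⟩ := hall
      rw [← hs0] at hg ⊢
      exact subnormal_eg h2 ha ha2 k s hsk hs g hg v hv
  have S : Setup F Dᵐᵒᵖ (Fin n → D) G M :=
    { h2 := h2
      hnc := by
        obtain ⟨a, b, hab⟩ := hnc
        exact ⟨MulOpposite.op b, MulOpposite.op a, fun h => hab (MulOpposite.op_injective h)⟩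
      hcent := by
        intro c hc
        obtain ⟨f, hf⟩ := hcent c.unop fun x => by
          have := congrArg MulOpposite.unop (hc (MulOpposite.op x))
          simpa using this.symm
        exact ⟨f, by rw [MulOpposite.algebraMap_apply, hf, MulOpposite.op_unop]⟩
      hlf := fin_end hloc n
      hEG := hEG
      hMG := hMG
      hmax := hmax
      hne := hne
      hsol := hsol }
  by_cases hE : ∃ E0 : Subalgebra F (Module.End Dᵐᵒᵖ (Fin n → D)),
      InvM M (E0 : Set (Module.End Dᵐᵒᵖ (Fin n → D))) ∧
      (∀ x ∈ E0, ∀ y ∈ E0, x * y = y * x) ∧ ∃ c ∈ E0, ¬ IsSc F c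
  · obtain ⟨E0, i1, i2, c, hc, hsc⟩ := hE
    obtain ⟨p, hp, hfr⟩ := caseI S hnonab E0 i1 i2 c hc hsc
    rw [← (matEquiv F D n).toLinearEquiv.finrank_eq, Module.finrank_matrix] at hfr
    simp only [Fintype.card_fin] at hfr
    have hnp : n ∣ p * p := ⟨n * Module.finrank F D, by rw [← hfr]; ring⟩
    have hnp' : n = p := by
      have h4 : n * n ∣ p * p := ⟨Module.finrank F D, hfr.symm⟩
      have h5 : n ∣ p := (Nat.pow_dvd_pow_iff two_ne_zero).1 (by simpa only [sq] using h4)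
      rcases (Nat.dvd_prime hp).1 h5 with h | h
      · omega
      · exact h
    subst hnp'
    have h1 : Module.finrank F D = 1 := by
      have : 0 < n * n := by positivity
      exact Nat.eq_of_mul_eq_mul_left this (by rw [hfr, mul_one])
    obtain ⟨a, b, hab⟩ := hnc
    obtain ⟨f, hf⟩ := (finrank_eq_one_iff_of_nonzero' (1 : D) one_ne_zero).1 h1 a
    apply hab
    rw [← hf]; simp
  · push Not at hE
    exact caseII S hnonab (fin_op hloc) fun E0 i1 i2 c hc => hE E0 i1 i2 c hc

end PartEleven

/-- Let `D` be a non-commutative locally finite division ring and `G` a subnormal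
subgroup of `GL_n(D)`, `n ≥ 1`.  If `M` is a non-abelian solvable maximal subgroup of
`G`, then `n = 1`. -/
theorem locallyFinite_solvable_maximal_n_eq_one {D : Type*} [DivisionRing D]
    (hnc : ∃ a b : D, a * b ≠ b * a)
    (hlf : IsLocallyFiniteDivisionRing D)
    (n : ℕ) (hn : 1 ≤ n)
    (G M : Subgroup (Matrix (Fin n) (Fin n) D)ˣ) (hG : IsSubnormal G)
    (hmax : M < G ∧ ∀ H : Subgroup (Matrix (Fin n) (Fin n) D)ˣ, M ≤ H → H ≤ G → H = M ∨ H = G)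
    (hsol : IsSolvable ↥M)
    (hnonab : ¬ ∀ x ∈ M, ∀ y ∈ M, x * y = y * x) :
    n = 1 := by
  by_contra hn1
  have hn2 : 2 ≤ n := by omega
  obtain ⟨k, s, hs0, hsk, hs⟩ := hG
  let e : (Matrix (Fin n) (Fin n) D)ˣ ≃* (Module.End Dᵐᵒᵖ (Fin n → D))ˣ :=
    Units.mapEquiv (matEquiv (Subring.center D) D n : _ ≃* _)
  have hinj : Function.Injective e.toMonoidHom := e.injective
  refine final_abs (F := Subring.center D) (D := D) ?_ ?_ hnc n hn2 (G.map e.toMonoidHom)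
    (M.map e.toMonoidHom) k (fun i => (s i).map e.toMonoidHom) (by simp [hs0]) ?_ ?_ ?_ ?_ ?_ ?_ ?_
  · intro c hc
    exact ⟨⟨c, Subring.mem_center_iff.2 fun x => (hc x).symm⟩, rfl⟩
  · intro S
    obtain ⟨t, ht⟩ := hlf (S : Set D) S.finite_toSet
    have h1 : FiniteDimensional (Subring.center D) (Submodule.span (Subring.center D) (t : Set D)) :=
      inferInstance
    refine Submodule.finiteDimensional_of_le (S₁ := Subalgebra.toSubmodule (Algebra.adjoin (Subring.center D) (S : Set D))) (S₂ := Submodule.span (Subring.center D) (t : Set D)) ?_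
    intro x hx
    apply ht
    have hx' : x ∈ Algebra.adjoin (Subring.center D) (S : Set D) := hx
    clear hx
    change x ∈ Subfield.closure ((S : Set D) ∪ (Subring.center D : Set D))
    induction hx' using Algebra.adjoin_induction with
    | mem x hx => exact Subfield.subset_closure (Or.inl hx)
    | algebraMap r => exact Subfield.subset_closure (Or.inr r.2)
    | add x y hx hy h1 h2 => exact add_mem h1 h2
    | mul x y hx hy h1 h2 => exact mul_mem h1 h2
  · change (s k).map e.toMonoidHom = ⊤
    rw [hsk]
    exact Subgroup.map_top_of_surjective _ e.surjective
  · intro i hi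
    obtain ⟨h1, h2⟩ := hs i hi
    refine ⟨Subgroup.map_mono h1, ?_⟩
    rw [Subgroup.normal_subgroupOf_iff (Subgroup.map_mono h1)]
    rw [Subgroup.normal_subgroupOf_iff h1] at h2
    rintro _ _ ⟨a, ha, rfl⟩ ⟨b, hb, rfl⟩
    exact ⟨b * a * b⁻¹, h2 a b ha hb, by simp⟩
  · exact Subgroup.map_mono hmax.1.le
  · intro h
    exact hmax.1.ne (Subgroup.map_injective hinj h)
  · intro H h1 h2
    have hH : (H.comap e.toMonoidHom).map e.toMonoidHom = H :=
      Subgroup.map_comap_eq_self_of_surjective e.surjective H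
    rcases hmax.2 (H.comap e.toMonoidHom) (Subgroup.map_le_iff_le_comap.1 h1) (by
      rw [← hH] at h2
      exact (Subgroup.map_le_map_iff_of_injective hinj).1 h2) with h | h
    · left; rw [← h, hH]
    · right; rw [← h, hH]
  · have : Group.IsSolvable M := hsol
    exact Group.isSolvable_of_surjective (f := (e.subgroupMap M).toMonoidHom) (e.subgroupMap M).surjective
  · intro h
    apply hnonab
    intro x hx y hy
    apply hinj
    rw [map_mul, map_mul]
    exact h _ ⟨x, hx, rfl⟩ _ ⟨y, hy, rfl⟩
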